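/- arXiv:2307.00126 — 9 statements merged into one kernel-verified Lean document; each statement's English description precedes it below -/
import Mathlib

section
/- Let h be μ-strongly convex with L-Lipschitz gradient (0 < μ ≤ L), let z* be its unique minimizer, and let κ = L/μ. If the accelerated gradient descent iteration is run with step size α = 1/L and momentum β = (√κ − 1)/(√κ + 1), then for every T ≥ 1 the iterate z_T satisfies ‖z_T − z*‖² ≤ (1 + κ)·(1 − 1/√κ)^T·‖z_0 − z*‖². -/
open Real Set

theorem HasGradientAt.hasDerivAt_comp_line {E : Type*} [NormedAddCommGroup E]
    [InnerProductSpace ℝ E] [CompleteSpace E] {h : E → ℝ} {g y d : E} {t : ℝ}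
    (hg : HasGradientAt h g (y + t • d)) :
    HasDerivAt (fun s : ℝ => h (y + s • d)) (inner ℝ g d) t := by
  have hline : HasDerivAt (fun s : ℝ => y + s • d) d t := by
    simpa using ((hasDerivAt_id t).smul_const d).const_add y
  simpa [Function.comp_def] using hg.hasFDerivAt.comp_hasDerivAt t hline

/-- The descent lemma: quadratic upper bound for a function with Lipschitz gradient. -/
theorem le_quadratic_of_lipschitz_gradient {E : Type*} [NormedAddCommGroup E]
    [InnerProductSpace ℝ E] [CompleteSpace E] {h : E → ℝ} {L : ℝ} (hL : 0 ≤ L)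
    (hdiff : Differentiable ℝ h)
    (hlip : LipschitzWith L.toNNReal (fun z => gradient h z)) (y d : E) :
    h (y + d) ≤ h y + inner ℝ (gradient h y) d + L / 2 * ‖d‖ ^ 2 := by
  set f : ℝ → ℝ := fun s =>
    h (y + s • d) - (s * inner ℝ (gradient h y) d + s ^ 2 * (L / 2 * ‖d‖ ^ 2)) with hf
  have hderiv : ∀ t : ℝ, HasDerivAt f (inner ℝ (gradient h (y + t • d)) d -
      (inner ℝ (gradient h y) d + 2 * t * (L / 2 * ‖d‖ ^ 2))) t := by
    intro t
    have h1 := ((hdiff (y + t • d)).hasGradientAt).hasDerivAt_comp_line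
    have h2 := (hasDerivAt_id t).mul_const (inner ℝ (gradient h y) d)
    have h3 := (hasDerivAt_pow 2 t).mul_const (L / 2 * ‖d‖ ^ 2)
    refine (h1.sub (h2.add h3)).congr_deriv ?_
    norm_num
  have hanti : AntitoneOn f (Set.Icc 0 1) := by
    refine antitoneOn_of_deriv_nonpos (convex_Icc 0 1)
      (fun t _ => (hderiv t).continuousAt.continuousWithinAt)
      (fun t _ => (hderiv t).differentiableAt.differentiableWithinAt) ?_
    intro t ht
    rw [interior_Icc] at ht
    rw [(hderiv t).deriv]
    have h1 := hlip.dist_le_mul (y + t • d) y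
    rw [dist_eq_norm, dist_eq_norm, Real.coe_toNNReal L hL, add_sub_cancel_left, norm_smul,
      Real.norm_of_nonneg ht.1.le] at h1
    have h2 := real_inner_le_norm (gradient h (y + t • d) - gradient h y) d
    rw [inner_sub_left] at h2
    have h3 := mul_le_mul_of_nonneg_right h1 (norm_nonneg d)
    nlinarith
  have := hanti (by simp : (0 : ℝ) ∈ Set.Icc 0 1) (by simp : (1 : ℝ) ∈ Set.Icc 0 1) zero_le_one
  simp only [hf, one_smul, zero_smul, add_zero] at this
  linarith

/-- Quadratic lower bound for a differentiable strongly convex function. -/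
theorem quadratic_le_of_strongly_convex {E : Type*} [NormedAddCommGroup E]
    [InnerProductSpace ℝ E] [CompleteSpace E] {h : E → ℝ} {μ : ℝ}
    (hdiff : Differentiable ℝ h)
    (hstrong : ConvexOn ℝ Set.univ (fun z => h z - μ / 2 * ‖z‖ ^ 2)) (y d : E) :
    h y + inner ℝ (gradient h y) d + μ / 2 * ‖d‖ ^ 2 ≤ h (y + d) := by
  set f : ℝ → ℝ := fun s => h (y + s • d) - μ / 2 * ‖y + s • d‖ ^ 2 with hf
  have hconv : ConvexOn ℝ Set.univ f := by
    have := hstrong.comp_affineMap (AffineMap.lineMap y (y + d))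
    simpa [Function.comp_def, AffineMap.lineMap_apply, add_comm] using this
  have hderiv : HasDerivAt f (inner ℝ (gradient h y) d - μ * inner ℝ y d) 0 := by
    have h1 : HasDerivAt (fun s : ℝ => h (y + s • d)) (inner ℝ (gradient h y) d) 0 := by
      apply HasGradientAt.hasDerivAt_comp_line
      simpa using (hdiff y).hasGradientAt
    have hline : HasDerivAt (fun s : ℝ => y + s • d) d 0 := by
      simpa using ((hasDerivAt_id (0 : ℝ)).smul_const d).const_add y
    have h2 := hline.norm_sq.const_mul (μ / 2)
    refine (h1.sub h2).congr_deriv ?_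
    simp only [zero_smul, add_zero]
    ring
  have := hconv.le_slope_of_hasDerivAt (Set.mem_univ 0) (Set.mem_univ 1) zero_lt_one hderiv
  simp only [slope_def_field, hf, one_smul, zero_smul, add_zero, sub_zero, div_one] at this
  rw [norm_add_sq_real] at this
  linarith

/-- One step of accelerated gradient descent contracts the energy
`h x - h z* + μ / 2 * ‖w - z*‖ ^ 2`, where `w = y + s • (y - x)` and `s ^ 2` is the condition
number. -/
theorem agd_energy_step {E : Type*} [NormedAddCommGroup E]
    [InnerProductSpace ℝ E] [CompleteSpace E] {h : E → ℝ} {μ L s : ℝ} (hμ : 0 < μ)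
    (hs : 1 ≤ s) (hL : L = s ^ 2 * μ) (hdiff : Differentiable ℝ h)
    (hstrong : ConvexOn ℝ Set.univ (fun z => h z - μ / 2 * ‖z‖ ^ 2))
    (hlip : LipschitzWith L.toNNReal (fun z => gradient h z)) (zstar x y x' y' : E)
    (hx' : x' = y - (1 / L) • gradient h y)
    (hy' : y' = x' + ((s - 1) / (s + 1)) • (x' - x)) :
    h x' - h zstar + μ / 2 * ‖y' + s • (y' - x') - zstar‖ ^ 2 ≤
      (1 - 1 / s) * (h x - h zstar + μ / 2 * ‖y + s • (y - x) - zstar‖ ^ 2) := by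
  have hs0 : 0 < s := by linarith
  have hs1 : s + 1 ≠ 0 := by linarith
  have hL0 : 0 < L := by rw [hL]; positivity
  set g := gradient h y with hg
  set q := 1 / s with hq
  have hq0 : 0 < q := by positivity
  have hq1 : q ≤ 1 := by rw [hq, div_le_one hs0]; exact hs
  have hqs : q * s = 1 := by rw [hq]; field_simp
  set b := y - zstar with hb
  set c := y - x with hc
  have hdesc : h x' ≤ h y - 1 / (2 * L) * ‖g‖ ^ 2 := by
    have := le_quadratic_of_lipschitz_gradient hL0.le hdiff hlip y (-((1 / L) • g))
    rw [← sub_eq_add_neg, ← hx', ← hg, inner_neg_right, real_inner_smul_right,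
      real_inner_self_eq_norm_sq, norm_neg, norm_smul, mul_pow, Real.norm_eq_abs, sq_abs] at this
    refine this.trans_eq ?_
    field_simp
    ring
  have hmin := quadratic_le_of_strongly_convex hdiff hstrong y (-b)
  have hprev := quadratic_le_of_strongly_convex hdiff hstrong y (-c)
  rw [inner_neg_right, norm_neg, ← hg] at hmin hprev
  rw [show y + -b = zstar by rw [hb]; abel] at hmin
  rw [show y + -c = x by rw [hc]; abel] at hprev
  have hw : y + s • c - zstar = b + s • c := by rw [hb]; abel
  have hw' : y' + s • (y' - x') - zstar = b + (s - 1) • c - (1 / (s * μ)) • g := by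
    rw [hy', hx', hb, hc, hL]
    match_scalars <;> field_simp <;> ring
  rw [hw, hw']
  have hexp' : ‖b + (s - 1) • c - (1 / (s * μ)) • g‖ ^ 2 = ‖b‖ ^ 2 + 2 * (s - 1) * inner ℝ b c
      + (s - 1) ^ 2 * ‖c‖ ^ 2 - 2 / (s * μ) * (inner ℝ g b + (s - 1) * inner ℝ g c)
      + 1 / (s * μ) ^ 2 * ‖g‖ ^ 2 := by
    rw [norm_sub_sq_real, norm_add_sq_real, inner_add_left, real_inner_smul_right,
      real_inner_smul_right, real_inner_smul_right, real_inner_smul_left, norm_smul, norm_smul,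
      mul_pow, mul_pow, Real.norm_eq_abs, Real.norm_eq_abs, sq_abs, sq_abs,
      real_inner_comm g b, real_inner_comm g c]
    ring
  have hexp : ‖b + s • c‖ ^ 2 = ‖b‖ ^ 2 + 2 * s * inner ℝ b c + s ^ 2 * ‖c‖ ^ 2 := by
    rw [norm_add_sq_real, real_inner_smul_right, norm_smul, mul_pow, Real.norm_eq_abs, sq_abs]
    ring
  rw [hexp', hexp]
  have hmin' := mul_le_mul_of_nonneg_left hmin hq0.le
  have hprev' := mul_le_mul_of_nonneg_left hprev (sub_nonneg.2 hq1)
  have hgap : 0 ≤ μ / 2 * ((1 - q) * s * ‖c‖ ^ 2) := by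
    have := sub_nonneg.2 hq1
    positivity
  have hgap' : 0 ≤ (1 - q) * (μ / 2 * ‖c‖ ^ 2) := by
    have := sub_nonneg.2 hq1
    positivity
  have hid : (1 - q) * (μ / 2 * (‖b‖ ^ 2 + 2 * s * inner ℝ b c + s ^ 2 * ‖c‖ ^ 2))
      + q * (μ / 2 * ‖b‖ ^ 2) - q * inner ℝ g b - (1 - q) * inner ℝ g c
      + 1 / (2 * L) * ‖g‖ ^ 2 - μ / 2 * ((1 - q) * s * ‖c‖ ^ 2)
      = μ / 2 * (‖b‖ ^ 2 + 2 * (s - 1) * inner ℝ b c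
      + (s - 1) ^ 2 * ‖c‖ ^ 2 - 2 / (s * μ) * (inner ℝ g b + (s - 1) * inner ℝ g c)
      + 1 / (s * μ) ^ 2 * ‖g‖ ^ 2) := by
    rw [hq, hL]
    field_simp
    ring
  linarith

/-- **AGD convergence for strongly convex functions.**
If `h` is `μ`-strongly convex with `L`-Lipschitz gradient (`0 < μ ≤ L`), `zstar` is its
minimizer and `κ = L/μ`, then accelerated gradient descent with step size `α = 1/L`
and momentum `β = (√κ − 1)/(√κ + 1)` satisfies
`‖z_T − z*‖² ≤ (1 + κ)(1 − 1/√κ)^T ‖z_0 − z*‖²` for every `T ≥ 1`. -/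
theorem agd_convergence
    {E : Type*} [NormedAddCommGroup E] [InnerProductSpace ℝ E] [FiniteDimensional ℝ E]
    (h : E → ℝ) (μ L : ℝ) (hμ : 0 < μ) (hμL : μ ≤ L)
    (hdiff : Differentiable ℝ h)
    (hstrong : ConvexOn ℝ Set.univ (fun z => h z - μ / 2 * ‖z‖ ^ 2))
    (hlip : LipschitzWith L.toNNReal (fun z => gradient h z))
    (zstar : E) (hmin : ∀ z, h zstar ≤ h z)
    (κ : ℝ) (hκ : κ = L / μ)
    (α β : ℝ) (hα : α = 1 / L) (hβ : β = (Real.sqrt κ - 1) / (Real.sqrt κ + 1))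
    (z ztilde : ℕ → E)
    (hinit : ztilde 0 = z 0)
    (hstep : ∀ t : ℕ, z (t + 1) = ztilde t - α • gradient h (ztilde t))
    (hmom : ∀ t : ℕ, ztilde (t + 1) = z (t + 1) + β • (z (t + 1) - z t))
    (T : ℕ) (hT : 1 ≤ T) :
    ‖z T - zstar‖ ^ 2 ≤ (1 + κ) * (1 - 1 / Real.sqrt κ) ^ T * ‖z 0 - zstar‖ ^ 2 := by
  set s := Real.sqrt κ with hs_def
  have hL0 : 0 < L := hμ.trans_le hμL
  have hκ1 : 1 ≤ κ := by rw [hκ, one_le_div hμ]; exact hμL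
  have hs : 1 ≤ s := Real.one_le_sqrt.2 hκ1
  have hLs : L = s ^ 2 * μ := by
    rw [hs_def, Real.sq_sqrt (by linarith), hκ]; field_simp
  have hq : 0 ≤ 1 - 1 / s := sub_nonneg.2 ((div_le_one (by linarith)).2 hs)
  have hgrad : gradient h zstar = 0 := by
    have hloc : IsLocalMin h zstar := Filter.Eventually.of_forall hmin
    simp [gradient, hloc.fderiv_eq_zero]
  have henergy : ∀ t : ℕ,
      h (z t) - h zstar + μ / 2 * ‖ztilde t + s • (ztilde t - z t) - zstar‖ ^ 2 ≤
        (1 - 1 / s) ^ t * (h (z 0) - h zstar + μ / 2 * ‖z 0 - zstar‖ ^ 2) := by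
    intro t
    induction t with
    | zero => simp [hinit]
    | succ t ih =>
      have hstep' := agd_energy_step hμ hs hLs hdiff hstrong hlip zstar (z t) (ztilde t)
        (z (t + 1)) (ztilde (t + 1)) (by rw [hstep, hα]) (by rw [hmom, hβ])
      rw [pow_succ' (1 - 1 / s), mul_assoc]
      exact hstep'.trans (mul_le_mul_of_nonneg_left ih hq)
  have hlow := quadratic_le_of_strongly_convex hdiff hstrong zstar (z T - zstar)
  have hup := le_quadratic_of_lipschitz_gradient hL0.le hdiff hlip zstar (z 0 - zstar)
  rw [hgrad, inner_zero_left, add_sub_cancel] at hlow hup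
  have hT' := henergy T
  have hnonneg : 0 ≤ μ / 2 * ‖ztilde T + s • (ztilde T - z T) - zstar‖ ^ 2 := by positivity
  have hinit' : h (z 0) - h zstar + μ / 2 * ‖z 0 - zstar‖ ^ 2 ≤
      μ / 2 * ((1 + κ) * ‖z 0 - zstar‖ ^ 2) := by
    have : μ * κ = L := by rw [hκ]; field_simp
    rw [← this] at hup
    linarith
  have hfin := mul_le_mul_of_nonneg_left hinit' (pow_nonneg hq T)
  have hμ2 : 0 < μ / 2 := by positivity
  refine le_of_mul_le_mul_left ?_ hμ2
  linarith
end

section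
/- Under the stated assumptions, the map x ↦ y*(x) is κ-Lipschitz: for all x, x' ∈ E, ‖y*(x) − y*(x')‖ ≤ κ·‖x − x'‖, where κ = ℓ/μ. -/
open Real Set

noncomputable section

/-- The point `(x, y)` of the `ℓ²` product `WithLp 2 (E × F)`. -/
abbrev pmk {E F : Type*} [NormedAddCommGroup E] [NormedAddCommGroup F]
    (x : E) (y : F) : WithLp 2 (E × F) :=
  (WithLp.equiv 2 (E × F)).symm (x, y)

/-- The derivative of `g` along the line `t ↦ (x, y + t w)` in the second factor. -/
lemma hasDerivAt_comp_pmk_line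
    {E F : Type*}
    [NormedAddCommGroup E] [InnerProductSpace ℝ E] [FiniteDimensional ℝ E]
    [NormedAddCommGroup F] [InnerProductSpace ℝ F] [FiniteDimensional ℝ F]
    {g : WithLp 2 (E × F) → ℝ} (hdiff : Differentiable ℝ g) (x : E) (y w : F) (t : ℝ) :
    HasDerivAt (fun s : ℝ => g (pmk x (y + s • w)))
      (inner ℝ (gradient g (pmk x (y + t • w))) (pmk 0 w)) t := by
  have hline : HasDerivAt (fun s : ℝ => pmk x y + s • pmk (0 : E) w) (pmk (0 : E) w) t := by
    simpa using ((hasDerivAt_id t).smul_const (pmk (0 : E) w)).const_add (pmk x y)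
  have heq : ∀ s : ℝ, pmk x y + s • pmk (0 : E) w = pmk x (y + s • w) := by
    intro s
    apply (WithLp.equiv 2 (E × F)).injective
    ext <;> simp [pmk]
  simp only [heq] at hline
  have hg := (hdiff (pmk x (y + t • w))).hasGradientAt.hasFDerivAt
  exact hg.comp_hasDerivAt t hline

/-- The partial gradient in the second factor vanishes at a minimizer. -/
lemma inner_gradient_pmk_eq_zero
    {E F : Type*}
    [NormedAddCommGroup E] [InnerProductSpace ℝ E] [FiniteDimensional ℝ E]
    [NormedAddCommGroup F] [InnerProductSpace ℝ F] [FiniteDimensional ℝ F]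
    {g : WithLp 2 (E × F) → ℝ} (hdiff : Differentiable ℝ g) {x : E} {y : F}
    (hmin : ∀ z : F, g (pmk x y) ≤ g (pmk x z)) (w : F) :
    inner ℝ (gradient g (pmk x y)) (pmk 0 w) = 0 := by
  have hd := hasDerivAt_comp_pmk_line hdiff x y w 0
  simp only [zero_smul, add_zero] at hd
  refine IsLocalMin.hasDerivAt_eq_zero (Filter.Eventually.of_forall fun s => ?_) hd
  simpa using hmin (y + s • w)

/-- Strong convexity in the second factor makes the partial gradient strongly monotone. -/
lemma mul_norm_sq_le_inner_gradient_sub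
    {E F : Type*}
    [NormedAddCommGroup E] [InnerProductSpace ℝ E] [FiniteDimensional ℝ E]
    [NormedAddCommGroup F] [InnerProductSpace ℝ F] [FiniteDimensional ℝ F]
    {g : WithLp 2 (E × F) → ℝ} {μ : ℝ} (hdiff : Differentiable ℝ g) {x : E}
    (hsc : ConvexOn ℝ Set.univ (fun y : F => g (pmk x y) - μ / 2 * ‖y‖ ^ 2)) (y w : F) :
    μ * ‖w‖ ^ 2 ≤
      inner ℝ (gradient g (pmk x (y + w))) (pmk 0 w) - inner ℝ (gradient g (pmk x y)) (pmk 0 w) := by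
  have hconv : ConvexOn ℝ Set.univ
      (fun t : ℝ => g (pmk x (y + t • w)) - μ / 2 * ‖y + t • w‖ ^ 2) := by
    have h := hsc.comp_affineMap (AffineMap.lineMap y (y + w) : ℝ →ᵃ[ℝ] F)
    simpa [Function.comp_def, AffineMap.lineMap_apply, add_comm] using h
  have hderiv : ∀ t : ℝ, HasDerivAt
      (fun t : ℝ => g (pmk x (y + t • w)) - μ / 2 * ‖y + t • w‖ ^ 2)
      (inner ℝ (gradient g (pmk x (y + t • w))) (pmk 0 w)
        - μ / 2 * (2 * inner ℝ (y + t • w) w)) t := by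
    intro t
    have hline : HasDerivAt (fun s : ℝ => y + s • w) w t := by
      simpa using ((hasDerivAt_id t).smul_const w).const_add y
    exact (hasDerivAt_comp_pmk_line hdiff x y w t).sub (hline.norm_sq.const_mul (μ / 2))
  have h0 := hconv.le_slope_of_hasDerivAt (Set.mem_univ 0) (Set.mem_univ 1) one_pos (hderiv 0)
  have h1 := hconv.slope_le_of_hasDerivAt (Set.mem_univ 0) (Set.mem_univ 1) one_pos (hderiv 1)
  have h := h0.trans h1
  simp only [zero_smul, add_zero, one_smul, inner_add_left, real_inner_self_eq_norm_sq] at h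
  linarith

/-- **Lipschitz continuity of the lower-level solution map.**
If `g : E × F → ℝ` is differentiable with `ℓ`-Lipschitz gradient and `μ`-strongly convex
in `y` for every fixed `x` (`0 < μ ≤ ℓ`), then the minimizer map `x ↦ y*(x)` is
`κ`-Lipschitz with `κ = ℓ/μ`. -/
theorem ystar_lipschitz
    {E F : Type*}
    [NormedAddCommGroup E] [InnerProductSpace ℝ E] [FiniteDimensional ℝ E]
    [NormedAddCommGroup F] [InnerProductSpace ℝ F] [FiniteDimensional ℝ F]
    (g : WithLp 2 (E × F) → ℝ) (ℓ μ : ℝ) (hμ : 0 < μ) (hμℓ : μ ≤ ℓ)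
    (hdiff : Differentiable ℝ g)
    (hlip : LipschitzWith ℓ.toNNReal (gradient g))
    (hsc : ∀ x : E, ConvexOn ℝ Set.univ (fun y : F => g (pmk x y) - μ / 2 * ‖y‖ ^ 2))
    (ystar : E → F)
    (hmin : ∀ x : E, ∀ y : F, g (pmk x (ystar x)) ≤ g (pmk x y))
    (κ : ℝ) (hκ : κ = ℓ / μ) :
    ∀ x x' : E, ‖ystar x - ystar x'‖ ≤ κ * ‖x - x'‖ := by
  intro x x'
  set w : F := ystar x - ystar x' with hw
  have hmono := mul_norm_sq_le_inner_gradient_sub hdiff (hsc x') (ystar x') w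
  rw [inner_gradient_pmk_eq_zero hdiff (hmin x') w, hw, add_sub_cancel, ← hw] at hmono
  have hzero := inner_gradient_pmk_eq_zero hdiff (hmin x) w
  have hnorm : ‖pmk (0 : E) w‖ = ‖w‖ := by simp [pmk]
  have hdist : ‖pmk x' (ystar x) - pmk x (ystar x)‖ = ‖x - x'‖ := by
    have : pmk x' (ystar x) - pmk x (ystar x) = pmk (x' - x) 0 := by
      apply (WithLp.equiv 2 (E × F)).injective
      ext <;> simp [pmk]
    rw [this, norm_sub_rev x x']
    simp [pmk]
  have hgrad := hlip.norm_sub_le (pmk x' (ystar x)) (pmk x (ystar x))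
  rw [hdist, Real.coe_toNNReal ℓ (hμ.le.trans hμℓ)] at hgrad
  have hcs := real_inner_le_norm
    (gradient g (pmk x' (ystar x)) - gradient g (pmk x (ystar x))) (pmk (0 : E) w)
  rw [inner_sub_left, hzero, hnorm] at hcs
  have hbound : μ * ‖w‖ ^ 2 ≤ ℓ * ‖x - x'‖ * ‖w‖ := by
    have := mul_le_mul_of_nonneg_right hgrad (norm_nonneg w)
    linarith
  rw [hκ, div_mul_eq_mul_div, le_div_iff₀ hμ]
  rcases (norm_nonneg w).eq_or_lt with h | h
  · rw [← h, zero_mul]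
    exact mul_nonneg (hμ.le.trans hμℓ) (norm_nonneg _)
  · refine le_of_mul_le_mul_right ?_ h
    linarith
end
end

section
/- In the setting below, suppose there is an integer 𝒦 with 1 ≤ 𝒦 such that k·Σ_{i=0}^{k−1}‖x_{i+1} − x_i‖² ≤ B² for every k < 𝒦, 𝒦·Σ_{i=0}^{𝒦−1}‖x_{i+1} − x_i‖² > B², and ‖∇Φ(w_{𝒦−1})‖ > B/η. Then Φ(x_𝒦) − Φ(x_0) ≤ −B²/(4η) + σB + (5ησ²𝒦)/8. -/
open Real Set Finset

/-- The quadratic upper bound for a function with Lipschitz gradient. -/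
theorem le_add_inner_add_of_lipschitz_gradient
    {E : Type*} [NormedAddCommGroup E] [InnerProductSpace ℝ E] [CompleteSpace E]
    {f : E → ℝ} {f' : E → E} {L : ℝ} (hf : ∀ z, HasGradientAt f (f' z) z)
    (hL : ∀ y z, ‖f' y - f' z‖ ≤ L * ‖y - z‖) (y z : E) :
    f z ≤ f y + inner ℝ (f' y) (z - y) + L / 2 * ‖z - y‖ ^ 2 := by
  have hline (t : ℝ) : HasDerivAt (fun t : ℝ => y + t • (z - y)) (z - y) t := by
    simpa using ((hasDerivAt_id t).smul_const (z - y)).const_add y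
  have hderiv (t : ℝ) : HasDerivAt
      (fun t : ℝ => f (y + t • (z - y)) - t * inner ℝ (f' y) (z - y)
        - t ^ 2 * (L / 2 * ‖z - y‖ ^ 2))
      (inner ℝ (f' (y + t • (z - y))) (z - y) - inner ℝ (f' y) (z - y)
        - t * (L * ‖z - y‖ ^ 2)) t := by
    have h₁ := (hf (y + t • (z - y))).hasFDerivAt.comp_hasDerivAt t (hline t)
    have h₂ := (hasDerivAt_id t).mul_const (inner ℝ (f' y) (z - y))
    have h₃ := (hasDerivAt_pow 2 t).mul_const (L / 2 * ‖z - y‖ ^ 2)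
    refine ((h₁.sub h₂).sub h₃).congr_deriv ?_
    simp only [InnerProductSpace.toDual_apply_apply, Nat.cast_ofNat, one_mul]
    ring
  have hanti := antitoneOn_of_deriv_nonpos (convex_Icc (0 : ℝ) 1)
    (fun t _ => (hderiv t).continuousAt.continuousWithinAt)
    (fun t _ => (hderiv t).differentiableAt.differentiableWithinAt)
    (fun t ht => by
      rw [interior_Icc] at ht
      rw [(hderiv t).deriv, ← inner_sub_left]
      have h₁ := real_inner_le_norm (f' (y + t • (z - y)) - f' y) (z - y)
      have h₂ := hL (y + t • (z - y)) y
      rw [add_sub_cancel_left, norm_smul, Real.norm_of_nonneg ht.1.le] at h₂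
      nlinarith [mul_le_mul_of_nonneg_right h₂ (norm_nonneg (z - y))])
  have h := hanti (left_mem_Icc.2 zero_le_one) (right_mem_Icc.2 zero_le_one) zero_le_one
  simp only [one_smul, zero_smul, add_sub_cancel, add_zero, one_mul, zero_mul, one_pow,
    sub_zero, ne_eq, OfNat.ofNat_ne_zero, not_false_eq_true, zero_pow] at h
  linarith

/-- One step `z = w - η • u` of an inexact gradient method started from the extrapolation `w` of
the current iterate `y`. -/
theorem inexact_extrapolated_step
    {E : Type*} [NormedAddCommGroup E] [InnerProductSpace ℝ E] [CompleteSpace E]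
    {f : E → ℝ} {f' : E → E} {L : ℝ} (hf : ∀ z, HasGradientAt f (f' z) z)
    (hL : ∀ y z, ‖f' y - f' z‖ ≤ L * ‖y - z‖) {η σ : ℝ} (hη : 0 < η) (hLη : L * η ≤ 1 / 4)
    {y w z u : E} (hu : ‖u - f' w‖ ≤ σ) (hz : z = w - η • u) :
    η * (f z - f y) + 3 / 8 * ‖z - w‖ ^ 2 + ‖z - y‖ ^ 2 / 2
      ≤ 5 / 8 * ‖w - y‖ ^ 2 + η * σ * ‖z - y‖ := by
  have h₁ := le_add_inner_add_of_lipschitz_gradient hf hL w z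
  have h₂ := le_add_inner_add_of_lipschitz_gradient (f := fun z => -f z) (f' := fun z => -f' z)
    (L := L) (fun z => by
      have h := (hf z).hasFDerivAt.neg
      rw [← map_neg] at h
      exact hasGradientAt_iff_hasFDerivAt.2 h)
    (fun a b => by rw [neg_sub_neg, norm_sub_rev]; exact hL a b) w y
  rw [inner_neg_left, norm_sub_rev y w] at h₂
  have hinner : inner ℝ (f' w) (z - w) - inner ℝ (f' w) (y - w) = inner ℝ (f' w) (z - y) := by
    rw [← inner_sub_right, sub_sub_sub_cancel_right]
  have hsplit : η * inner ℝ (f' w) (z - y)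
      = -inner ℝ (z - w) (z - y) - η * inner ℝ (u - f' w) (z - y) := by
    have hg : η • f' w = -(z - w) - η • (u - f' w) := by rw [hz, smul_sub]; abel
    rw [← real_inner_smul_left, hg, inner_sub_left, inner_neg_left, real_inner_smul_left]
  have herr : -inner ℝ (u - f' w) (z - y) ≤ σ * ‖z - y‖ :=
    (neg_le_abs _).trans <| (abs_real_inner_le_norm _ _).trans <|
      mul_le_mul_of_nonneg_right hu (norm_nonneg _)
  have hpolar : ‖w - y‖ ^ 2 = ‖z - y‖ ^ 2 - 2 * inner ℝ (z - w) (z - y) + ‖z - w‖ ^ 2 := by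
    rw [real_inner_comm, ← norm_sub_sq_real, sub_sub_sub_cancel_left]
  have hsum : f z - f y
      ≤ inner ℝ (f' w) (z - y) + L / 2 * (‖z - w‖ ^ 2 + ‖w - y‖ ^ 2) := by linarith
  have hsq : 0 ≤ ‖z - w‖ ^ 2 + ‖w - y‖ ^ 2 := by positivity
  linarith [mul_le_mul_of_nonneg_left hsum hη.le, mul_le_mul_of_nonneg_left herr hη.le,
    mul_le_mul_of_nonneg_right hLη hsq]

/-- The scalar estimate behind an epoch with a single step. -/
theorem single_step_scalar_bound {D a B τ : ℝ} (hB : 0 < B) (hτ : 0 ≤ τ) (ha : B - τ ≤ a)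
    (hD : D + 7 / 8 * a ^ 2 ≤ τ * a) : D ≤ -B ^ 2 / 4 + τ * B + 5 / 8 * τ ^ 2 := by
  rcases le_total τ B with h | h
  · nlinarith [sq_nonneg (a - τ), mul_self_le_mul_self (sub_nonneg.2 h) ha, mul_nonneg hB.le hτ]
  · nlinarith [sq_nonneg (a - τ), sq_nonneg a, mul_le_mul_of_nonneg_left h hB.le]

/-- The scalar estimate behind an epoch with `m + 2` steps: `a` and `b` are the lengths of the
first and last steps, `S` and `Q` the sums of the lengths and of the squared lengths of the `m`
steps in between, and `G` is the length of the last gradient step. -/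
theorem multi_step_scalar_bound {D a b S Q G B τ : ℝ} {m : ℕ} (hB : 0 < B) (hτ : 0 ≤ τ)
    (hS : S ^ 2 ≤ m * Q) (hQ : 0 ≤ Q) (hQB : (m + 1) * (a ^ 2 + Q) ≤ B ^ 2) (hG : B - τ ≤ G)
    (hD : D + 3 / 8 * a ^ 2 + 3 / 8 * G ^ 2 + b ^ 2 / 2
      ≤ 1 / 8 * (a ^ 2 + Q) + τ * (a + S) + τ * b) :
    D ≤ -B ^ 2 / 4 + τ * B + 5 / 8 * τ ^ 2 * (m + 2) := by
  have hm : (0 : ℝ) ≤ m := m.cast_nonneg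
  have hb : τ * b ≤ τ ^ 2 / 2 + b ^ 2 / 2 := by linarith [sq_nonneg (b - τ)]
  have ha : τ * a ≤ 3 / 8 * a ^ 2 + 2 / 3 * τ ^ 2 := by linarith [sq_nonneg (3 * a - 4 * τ)]
  have hma : 0 ≤ m * a ^ 2 := by positivity
  have hSB : S ≤ B := abs_le_of_sq_le_sq' (by nlinarith) hB.le |>.2
  rcases le_total τ B with h | h
  · have hG2 : (B - τ) ^ 2 ≤ G ^ 2 := pow_le_pow_left₀ (sub_nonneg.2 h) hG 2
    have key : τ * S ≤ m * (a ^ 2 + Q) / 8 + (B ^ 2 - (m + 1) * (a ^ 2 + Q)) / 8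
        + τ * B / 4 + (5 / 8 * m + 11 / 24) * τ ^ 2 := by
      have hSm : S ^ 2 ≤ m * (a ^ 2 + Q) := by linarith
      obtain _ | _ | m := m
      · have hS0 : S = 0 := by simpa using hSm.antisymm (by simpa using sq_nonneg S)
        norm_num [hS0] at hQB ⊢
        nlinarith [mul_nonneg hτ hB.le, sq_nonneg τ]
      · norm_num at hSm hQB ⊢
        have hSB' : 6 / 5 * S ≤ B := abs_le_of_sq_le_sq' (by nlinarith) hB.le |>.2
        linarith [mul_le_mul_of_nonneg_left hSB' hτ, sq_nonneg (5 * S - 14 * τ), sq_nonneg τ]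
      · push_cast at hSm hQB ⊢
        linarith [mul_le_mul_of_nonneg_left hSB hτ, sq_nonneg (S - 3 * τ), sq_nonneg τ,
          mul_nonneg m.cast_nonneg (sq_nonneg τ)]
    linarith
  · have haS : 2 * (a * S) ≤ m * a ^ 2 + Q := by
      refine abs_le_of_sq_le_sq' ?_ (by positivity) |>.2
      linarith [mul_le_mul_of_nonneg_left hS (sq_nonneg a), sq_nonneg (m * a ^ 2 - Q)]
    have haSB : a + S ≤ B := abs_le_of_sq_le_sq' (by linarith) hB.le |>.2
    have hBτ : B ^ 2 ≤ τ ^ 2 := pow_le_pow_left₀ hB.le h 2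
    have hmQ : 0 ≤ m * Q := by positivity
    linarith [mul_le_mul_of_nonneg_left haSB hτ, sq_nonneg a, sq_nonneg G,
      mul_nonneg hm (sq_nonneg τ)]

/-- **Decrease of the objective over one epoch in the large-gradient case.**
For the inexact accelerated recursion, if `𝒦 ≥ 1` is such that the restart condition
holds at `𝒦` but not before, and `‖∇Φ(w_{𝒦−1})‖ > B/η`, then
`Φ(x_𝒦) − Φ(x_0) ≤ −B²/(4η) + σB + 5ησ²𝒦/8`. -/
theorem epoch_decrease_large_gradient
    {E : Type*} [NormedAddCommGroup E] [InnerProductSpace ℝ E] [FiniteDimensional ℝ E]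
    (Φ : E → ℝ) (Ltil : ℝ) (hL : 0 < Ltil)
    (hdiff : Differentiable ℝ Φ)
    (hlip : LipschitzWith Ltil.toNNReal (gradient Φ))
    (η θ σ B : ℝ) (hη0 : 0 < η) (hη : η ≤ 1 / (4 * Ltil))
    (hθ0 : 0 ≤ θ) (hθ1 : θ ≤ 1) (hσ : 0 ≤ σ) (hB : 0 < B)
    (x w u : ℕ → E)
    (hw0 : w 0 = x 0)
    (hw : ∀ k : ℕ, w (k + 1) = x (k + 1) + (1 - θ) • (x (k + 1) - x k))
    (hu : ∀ k : ℕ, ‖u k - gradient Φ (w k)‖ ≤ σ)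
    (hx : ∀ k : ℕ, x (k + 1) = w k - η • u k)
    (K : ℕ) (hK1 : 1 ≤ K)
    (hbefore : ∀ k < K, (k : ℝ) * ∑ i ∈ Finset.range k, ‖x (i + 1) - x i‖ ^ 2 ≤ B ^ 2)
    (htrigger : (K : ℝ) * ∑ i ∈ Finset.range K, ‖x (i + 1) - x i‖ ^ 2 > B ^ 2)
    (hgrad : ‖gradient Φ (w (K - 1))‖ > B / η) :
    Φ (x K) - Φ (x 0) ≤ -B ^ 2 / (4 * η) + σ * B + 5 * η * σ ^ 2 * K / 8 := by
  have hgr : ∀ z, HasGradientAt Φ (gradient Φ z) z := fun z => (hdiff z).hasGradientAt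
  have hLn : ∀ y z, ‖gradient Φ y - gradient Φ z‖ ≤ Ltil * ‖y - z‖ := fun y z => by
    simpa [Real.coe_toNNReal _ hL.le] using hlip.norm_sub_le y z
  have hLη : Ltil * η ≤ 1 / 4 := by
    rw [le_div_iff₀ (by positivity)] at hη
    linarith
  have hτ : 0 ≤ η * σ := by positivity
  have hstep (k : ℕ) := inexact_extrapolated_step hgr hLn hη0 hLη (y := x k) (hu k) (hx k)
  have hstep₀ : η * (Φ (x 1) - Φ (x 0)) + 7 / 8 * ‖x 1 - x 0‖ ^ 2 ≤ η * σ * ‖x 1 - x 0‖ := by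
    have h := hstep 0
    rw [hw0, sub_self, norm_zero] at h
    linarith
  have hextra (k : ℕ) : ‖w (k + 1) - x (k + 1)‖ ^ 2 ≤ ‖x (k + 1) - x k‖ ^ 2 := by
    rw [hw k, add_sub_cancel_left, norm_smul, Real.norm_of_nonneg (by linarith)]
    gcongr
    exact mul_le_of_le_one_left (norm_nonneg _) (by linarith)
  have hprefix (m : ℕ) : η * (Φ (x (m + 1)) - Φ (x 0)) + 3 / 8 * ‖x 1 - x 0‖ ^ 2
      + ‖x (m + 1) - x m‖ ^ 2 / 2 ≤ 1 / 8 * ∑ i ∈ Finset.range m, ‖x (i + 1) - x i‖ ^ 2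
        + η * σ * ∑ i ∈ Finset.range (m + 1), ‖x (i + 1) - x i‖ := by
    induction m with
    | zero => simp only [zero_add, Finset.sum_range_zero, Finset.sum_range_one]; linarith
    | succ m ih =>
      rw [Finset.sum_range_succ, Finset.sum_range_succ _ (m + 1)]
      linarith [hstep (m + 1), hextra m, sq_nonneg ‖x (m + 1 + 1) - w (m + 1)‖]
  have hlast : B - η * σ ≤ ‖x (K - 1 + 1) - w (K - 1)‖ := by
    have h₁ : ‖x (K - 1 + 1) - w (K - 1)‖ = η * ‖u (K - 1)‖ := by
      rw [hx, sub_sub_cancel_left, norm_neg, norm_smul, Real.norm_of_nonneg hη0.le]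
    have h₂ := norm_sub_norm_le (gradient Φ (w (K - 1))) (u (K - 1))
    rw [norm_sub_rev] at h₂
    rw [gt_iff_lt, div_lt_iff₀ hη0] at hgrad
    nlinarith [hu (K - 1)]
  suffices h : η * (Φ (x K) - Φ (x 0))
      ≤ -B ^ 2 / 4 + η * σ * B + 5 / 8 * (η * σ) ^ 2 * K by
    refine le_of_mul_le_mul_left (h.trans_eq ?_) hη0
    field_simp
  obtain _ | _ | m := K
  · omega
  · simp only [zero_add, Nat.sub_self, hw0] at hlast
    simpa using single_step_scalar_bound hB hτ hlast hstep₀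
  · have hQB := hbefore (m + 1) (by omega)
    have hD := hprefix m
    have hl := hstep (m + 1)
    rw [Finset.sum_range_succ'] at hQB
    rw [Finset.sum_range_succ'] at hD
    have hsum : ∑ i ∈ Finset.range m, ‖x (i + 1) - x i‖ ^ 2 + ‖x (m + 1) - x m‖ ^ 2
        = ∑ i ∈ Finset.range m, ‖x (i + 1 + 1) - x (i + 1)‖ ^ 2 + ‖x 1 - x 0‖ ^ 2 := by
      rw [← Finset.sum_range_succ, Finset.sum_range_succ']
    have hCS := sq_sum_le_card_mul_sum_sq (s := Finset.range m)
      (f := fun i => ‖x (i + 1 + 1) - x (i + 1)‖)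
    rw [Finset.card_range] at hCS
    have h := multi_step_scalar_bound (D := η * (Φ (x (m + 1 + 1)) - Φ (x 0)))
      (a := ‖x 1 - x 0‖) (b := ‖x (m + 1 + 1) - x (m + 1)‖) hB hτ hCS
      (Finset.sum_nonneg fun i _ => sq_nonneg _) (by push_cast at hQB; linarith) hlast
      (by simp only [zero_add, Nat.add_sub_cancel] at hD ⊢; linarith [hextra m])
    push_cast
    linarith
end

section
/- Let L̃ > 0, 0 < η ≤ 1/(4L̃), θ ∈ (0,1], and let φ : ℝ → ℝ be the quadratic φ(x) = g_0·(x − x_0) + (λ/2)(x − x_0)² with −θ/η ≤ λ ≤ L̃. Let x : ℕ → ℝ satisfy the inexact accelerated recursion below with |δ_k| ≤ δ̄ for all k ≥ 0. Then for every 𝒦 ≥ 1: φ(x_𝒦) − φ(x_0) ≤ −(3θ/(8η))·Σ_{k=0}^{𝒦−1}(x_{k+1} − x_k)² + (2η𝒦/θ)·δ̄². -/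
open Real Set Finset

/-- One inexact accelerated step from `w = u + (1 - θ) (u - p)` to `v`, where `G` is the derivative
of the quadratic at `u`. -/
theorem quadratic_accelerated_step_decrease {Ltil η θ lam δbar : ℝ}
    (hL : 0 < Ltil) (hη0 : 0 < η) (hη : η ≤ 1 / (4 * Ltil))
    (hθ0 : 0 < θ) (hθ1 : θ ≤ 1) (hlam_lb : -(θ / η) ≤ lam) (hlam_ub : lam ≤ Ltil)
    {p u v G δ : ℝ} (hδ : |δ| ≤ δbar)
    (hv : v = u + (1 - θ) * (u - p) - η * (G + lam * ((1 - θ) * (u - p)) + δ)) :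
    G * (v - u) + lam / 2 * (v - u) ^ 2 ≤
      (1 - θ) * (1 - η * lam) / (2 * η) * ((u - p) ^ 2 - (v - u) ^ 2)
        - 3 * θ / (8 * η) * (v - u) ^ 2 + 2 * η / θ * δbar ^ 2 := by
  have ha_lb : -θ ≤ η * lam := by
    have := mul_le_mul_of_nonneg_left hlam_lb hη0.le
    rwa [mul_neg, mul_div_cancel₀ _ hη0.ne'] at this
  have ha_ub : η * lam ≤ 1 / 4 := by
    rw [le_div_iff₀ (by positivity)] at hη
    nlinarith
  have hs : 0 ≤ (1 - θ) * (1 - η * lam) := mul_nonneg (by linarith) (by linarith)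
  have hcoef : 0 ≤ θ + η * lam - 2 * (η * lam) * θ := by
    nlinarith [mul_nonneg hθ0.le (sub_nonneg.2 ha_ub)]
  have hδsq : δ ^ 2 ≤ δbar ^ 2 := sq_le_sq.2 (hδ.trans (le_abs_self _))
  have hG : G = ((1 - θ) * (1 - η * lam) * (u - p) - (v - u)) / η - δ := by
    field_simp
    linarith
  have hyoung : G * (v - u) + lam / 2 * (v - u) ^ 2 + (1 - θ) * (1 - η * lam) / (2 * η)
        * ((u - p) - (v - u)) ^ 2 + (θ + η * lam - 2 * (η * lam) * θ) / (2 * η) * (v - u) ^ 2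
        + θ / (8 * η) * ((v - u) + 4 * η * δ / θ) ^ 2 =
      (1 - θ) * (1 - η * lam) / (2 * η) * ((u - p) ^ 2 - (v - u) ^ 2)
        - 3 * θ / (8 * η) * (v - u) ^ 2 + 2 * η / θ * δ ^ 2 := by
    rw [hG]
    field_simp
    ring
  have hgap : 0 ≤ (1 - θ) * (1 - η * lam) / (2 * η) * ((u - p) - (v - u)) ^ 2 := by positivity
  have hcurv : 0 ≤ (θ + η * lam - 2 * (η * lam) * θ) / (2 * η) * (v - u) ^ 2 := by positivity
  have hnoise : 0 ≤ θ / (8 * η) * ((v - u) + 4 * η * δ / θ) ^ 2 := by positivity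
  have hbar : 2 * η / θ * δ ^ 2 ≤ 2 * η / θ * δbar ^ 2 := by gcongr
  linarith

/-- **Decrease along strong-curvature directions (λ ≥ −θ/η).**
For the scalar inexact accelerated recursion on the quadratic
`φ(s) = g₀(s − x₀) + (λ/2)(s − x₀)²` with `−θ/η ≤ λ ≤ L̃` and perturbations bounded by
`δ̄`, one has for every `𝒦 ≥ 1`:
`φ(x_𝒦) − φ(x_0) ≤ −(3θ/(8η))·Σ_{k<𝒦}(x_{k+1} − x_k)² + (2η𝒦/θ)·δ̄²`. -/
theorem scalar_quadratic_decrease_large_eigenvalue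
    (Ltil η θ g₀ lam δbar : ℝ)
    (hL : 0 < Ltil) (hη0 : 0 < η) (hη : η ≤ 1 / (4 * Ltil))
    (hθ0 : 0 < θ) (hθ1 : θ ≤ 1)
    (hlam_lb : -(θ / η) ≤ lam) (hlam_ub : lam ≤ Ltil)
    (φ : ℝ → ℝ) (x w : ℕ → ℝ) (δ : ℕ → ℝ)
    (hφ : ∀ s : ℝ, φ s = g₀ * (s - x 0) + lam / 2 * (s - x 0) ^ 2)
    (hδ : ∀ k : ℕ, |δ k| ≤ δbar)
    (hw0 : w 0 = x 0)
    (hw : ∀ k : ℕ, w (k + 1) = x (k + 1) + (1 - θ) * (x (k + 1) - x k))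
    (hx : ∀ k : ℕ, x (k + 1) = w k - η * (deriv φ (w k) + δ k)) :
    ∀ K : ℕ, 1 ≤ K →
      φ (x K) - φ (x 0) ≤
        -(3 * θ / (8 * η)) * ∑ k ∈ Finset.range K, (x (k + 1) - x k) ^ 2
          + (2 * η * K / θ) * δbar ^ 2 := by
  have hderiv (s : ℝ) : deriv φ s = g₀ + lam * (s - x 0) := by
    have h : HasDerivAt (fun s => s - x 0) 1 s := (hasDerivAt_id s).sub_const _
    rw [funext hφ]
    refine ((h.const_mul g₀).add ((h.pow 2).const_mul (lam / 2))).deriv.trans ?_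
    norm_num
    ring
  have hw' (k : ℕ) : w k = x k + (1 - θ) * (x k - x (k - 1)) := by
    cases k with
    | zero => simp [hw0]
    | succ k => simpa using hw k
  have ha_ub : η * lam ≤ 1 := by
    rw [le_div_iff₀ (by positivity)] at hη
    nlinarith
  have hs : 0 ≤ (1 - θ) * (1 - η * lam) := mul_nonneg (by linarith) (by linarith)
  have henergy (K : ℕ) : φ (x K) - φ (x 0)
      + (1 - θ) * (1 - η * lam) / (2 * η) * (x K - x (K - 1)) ^ 2 ≤
        -(3 * θ / (8 * η)) * ∑ k ∈ Finset.range K, (x (k + 1) - x k) ^ 2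
          + (2 * η * K / θ) * δbar ^ 2 := by
    induction K with
    | zero => simp
    | succ k ih =>
      have hstep := quadratic_accelerated_step_decrease hL hη0 hη hθ0 hθ1 hlam_lb hlam_ub
        (p := x (k - 1)) (u := x k) (v := x (k + 1)) (G := g₀ + lam * (x k - x 0)) (hδ k)
        (by rw [hx k, hderiv, hw' k]; ring)
      have hinc : φ (x (k + 1)) - φ (x k) = (g₀ + lam * (x k - x 0)) * (x (k + 1) - x k)
          + lam / 2 * (x (k + 1) - x k) ^ 2 := by
        rw [hφ, hφ]; ring
      have hcount : 2 * η * ((k + 1 : ℕ) : ℝ) / θ = 2 * η * k / θ + 2 * η / θ := by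
        push_cast; ring
      rw [Finset.sum_range_succ, hcount, Nat.add_sub_cancel]
      linarith
  intro K _
  have hpot : 0 ≤ (1 - θ) * (1 - η * lam) / (2 * η) * (x K - x (K - 1)) ^ 2 := by positivity
  linarith [henergy K]
end

section
/- Let L̃ > 0, 0 < η ≤ 1/(4L̃), θ ∈ (0,1), and let φ : ℝ → ℝ be the quadratic φ(x) = (λ/2)(x − ν)² − c with −L̃ ≤ λ < −θ/η. Let x : ℕ → ℝ satisfy the inexact accelerated recursion below with |δ_0| ≤ σ_0 and |δ_k| ≤ δ̄ for all k ≥ 1. Then for every 𝒦 ≥ 1: φ(x_𝒦) − φ(x_0) ≤ −(θ/(2η))·Σ_{k=0}^{𝒦−1}(x_{k+1} − x_k)² + (η𝒦/(2θ))·σ_0² + (η𝒦/(2θ))·δ̄². -/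
open Real Set Finset

/-- One step of the momentum recursion, in the normalized curvature `h = -ηλ`, contracts the
negated displacement product `-(h * y * d)` by the factor `1 - θ` up to the perturbation `e`. -/
lemma neg_displacement_product_step {h θ y d d' e : ℝ} (hθ0 : 0 < θ) (hθh : θ < h)
    (hh : h ≤ 1 / 4)
    (hd' : d' = (1 - θ) * (1 + h) * d + h * (y + d) - e) :
    -(h * (y + d) * d') ≤ (1 - θ) * -(h * y * d) + e ^ 2 / 2 := by
  have hh0 : 0 < h := hθ0.trans hθh
  have hcoef : 0 ≤ (1 - θ) * (1 + h) + h / 2 - h * (2 - θ) ^ 2 / 2 := by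
    have hb : 3 / 4 ≤ (1 - θ) * (1 + h) := by nlinarith
    have hsq : (2 - θ) ^ 2 ≤ 4 := by nlinarith
    nlinarith
  have hquad : 0 ≤ h * (h / 2 * (y + (2 - θ) * d) ^ 2
      + d ^ 2 * ((1 - θ) * (1 + h) + h / 2 - h * (2 - θ) ^ 2 / 2)) := by positivity
  subst hd'
  linarith [sq_nonneg (h * (y + d) - e)]

/-- A contraction with factor `1 - θ` and additive error `B ≤ θ * M` preserves the bound `M`. -/
lemma le_of_contraction_step {p : ℕ → ℝ} {θ B M : ℝ} (hθ1 : θ ≤ 1) (hp0 : p 0 ≤ M)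
    (hB : B ≤ θ * M) (hstep : ∀ k, p (k + 1) ≤ (1 - θ) * p k + B) (k : ℕ) : p k ≤ M := by
  induction k with
  | zero => exact hp0
  | succ k ih => linarith [hstep k, mul_le_mul_of_nonneg_left ih (sub_nonneg.2 hθ1)]

lemma deriv_shifted_quadratic (lam ν c s : ℝ) :
    deriv (fun s : ℝ => lam / 2 * (s - ν) ^ 2 - c) s = lam * (s - ν) := by
  have h := (((((hasDerivAt_id s).sub_const ν).pow 2).const_mul (lam / 2)).sub_const c).deriv
  simp only [id] at h
  refine Eq.trans h ?_
  push_cast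
  ring

/-- **Decrease along escaping directions (λ < −θ/η).**
For the scalar inexact accelerated recursion on the quadratic
`φ(s) = (λ/2)(s − ν)² − c` with `−L̃ ≤ λ < −θ/η`, perturbations satisfying `|δ₀| ≤ σ₀`
and `|δ_k| ≤ δ̄` for `k ≥ 1`, one has for every `𝒦 ≥ 1`:
`φ(x_𝒦) − φ(x_0) ≤ −(θ/(2η))·Σ_{k<𝒦}(x_{k+1} − x_k)² + (η𝒦/(2θ))σ₀² + (η𝒦/(2θ))δ̄²`. -/
theorem scalar_quadratic_decrease_negative_eigenvalue
    (Ltil η θ lam ν c σ₀ δbar : ℝ)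
    (hL : 0 < Ltil) (hη0 : 0 < η) (hη : η ≤ 1 / (4 * Ltil))
    (hθ0 : 0 < θ) (hθ1 : θ < 1)
    (hlam_lb : -Ltil ≤ lam) (hlam_ub : lam < -(θ / η))
    (φ : ℝ → ℝ) (x w : ℕ → ℝ) (δ : ℕ → ℝ)
    (hφ : ∀ s : ℝ, φ s = lam / 2 * (s - ν) ^ 2 - c)
    (hδ0 : |δ 0| ≤ σ₀) (hδ : ∀ k : ℕ, 1 ≤ k → |δ k| ≤ δbar)
    (hw0 : w 0 = x 0)
    (hw : ∀ k : ℕ, w (k + 1) = x (k + 1) + (1 - θ) * (x (k + 1) - x k))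
    (hx : ∀ k : ℕ, x (k + 1) = w k - η * (deriv φ (w k) + δ k)) :
    ∀ K : ℕ, 1 ≤ K →
      φ (x K) - φ (x 0) ≤
        -(θ / (2 * η)) * ∑ k ∈ Finset.range K, (x (k + 1) - x k) ^ 2
          + (η * K / (2 * θ)) * σ₀ ^ 2 + (η * K / (2 * θ)) * δbar ^ 2 := by
  have hderiv : ∀ s, deriv φ s = lam * (s - ν) := fun s => by
    rw [funext hφ, deriv_shifted_quadratic]
  have hθh : θ < -(η * lam) := by
    have h := mul_lt_mul_of_pos_left hlam_ub hη0
    have h' : η * -(θ / η) = -θ := by field_simp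
    linarith
  have hh : -(η * lam) ≤ 1 / 4 := by
    rw [le_div_iff₀ (by positivity)] at hη
    nlinarith
  have hδ0_sq : δ 0 ^ 2 ≤ σ₀ ^ 2 := sq_le_sq' (neg_le_of_abs_le hδ0) (le_of_abs_le hδ0)
  have hδ_sq : ∀ k, δ (k + 1) ^ 2 ≤ δbar ^ 2 := fun k =>
    have h := hδ (k + 1) (Nat.le_add_left 1 k)
    sq_le_sq' (neg_le_of_abs_le h) (le_of_abs_le h)
  set M : ℝ := η ^ 2 * (σ₀ ^ 2 + δbar ^ 2) / (2 * θ) with hM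
  have hθM : θ * M = η ^ 2 * (σ₀ ^ 2 + δbar ^ 2) / 2 := by rw [hM]; field_simp
  have hM0 : 0 ≤ M := by positivity
  have hprod : ∀ k, η * lam * (x k - ν) * (x (k + 1) - x k) ≤ M := by
    refine le_of_contraction_step (B := η ^ 2 * δbar ^ 2 / 2) hθ1.le ?_ ?_ fun k => ?_
    · have hx0 : x (0 + 1) - x 0 = -(η * lam) * (x 0 - ν) - η * δ 0 := by
        rw [hx 0, hderiv, hw0]; ring
      rw [hx0]
      have hθM_le : θ * M ≤ M := mul_le_of_le_one_left hM0 hθ1.le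
      have hnoise := mul_le_mul_of_nonneg_left hδ0_sq (sq_nonneg η)
      linarith [sq_nonneg (η * lam * (x 0 - ν) + η * δ 0),
        sq_nonneg (η * lam * (x 0 - ν)), mul_nonneg (sq_nonneg η) (sq_nonneg δbar)]
    · rw [hθM]
      linarith [mul_nonneg (sq_nonneg η) (sq_nonneg σ₀)]
    · have hd : x (k + 1 + 1) - x (k + 1) = (1 - θ) * (1 + -(η * lam)) * (x (k + 1) - x k)
          + -(η * lam) * ((x k - ν) + (x (k + 1) - x k)) - η * δ (k + 1) := by
        rw [hx (k + 1), hderiv, hw]; ring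
      have hnoise := mul_le_mul_of_nonneg_left (hδ_sq k) (sq_nonneg η)
      linarith [neg_displacement_product_step hθ0 hθh hh hd]
  have hstep : ∀ k, φ (x (k + 1)) - φ (x k) ≤
      -(θ / (2 * η)) * (x (k + 1) - x k) ^ 2 + M / η := fun k => by
    have hcurv := mul_le_mul_of_nonneg_right hθh.le (sq_nonneg (x (k + 1) - x k))
    rw [hφ, hφ, show -(θ / (2 * η)) * (x (k + 1) - x k) ^ 2 + M / η =
      (M - θ * (x (k + 1) - x k) ^ 2 / 2) / η by field_simp; ring, le_div_iff₀ hη0]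
    linarith [hprod k]
  intro K _
  have hsum := Finset.sum_le_sum fun k (_ : k ∈ Finset.range K) => hstep k
  rw [Finset.sum_range_sub (fun k => φ (x k)), Finset.sum_add_distrib, ← Finset.mul_sum,
    Finset.sum_const, Finset.card_range, nsmul_eq_mul] at hsum
  have hMK : K * (M / η) = η * K / (2 * θ) * σ₀ ^ 2 + η * K / (2 * θ) * δbar ^ 2 := by
    rw [hM]; field_simp
  linarith
end

section
/- Let L̃ > 0, 0 < η ≤ 1/(4L̃), θ ∈ (0,1), and let φ : ℝ → ℝ be the quadratic φ(x) = (λ/2)(x − ν)² with −L̃ ≤ λ < −θ/η. Let x : ℕ → ℝ satisfy the inexact accelerated recursion below. Then for every k ≥ 0: (x_{k+1} − x_k)(x_k − ν) ≥ (1−θ)(x_k − x_{k−1})(x_{k−1} − ν) + (η/(2λ))·δ_k² (the last term is nonpositive since λ < 0; for k = 0, x_{−1} = x_0). -/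
open Real Set

theorem deriv_half_mul_sub_sq {φ : ℝ → ℝ} {lam ν : ℝ}
    (hφ : ∀ s : ℝ, φ s = lam / 2 * (s - ν) ^ 2) (s : ℝ) : deriv φ s = lam * (s - ν) := by
  rw [funext hφ]
  have h : HasDerivAt (fun s : ℝ => lam / 2 * (s - ν) ^ 2)
      (lam / 2 * ((2 : ℕ) * (s - ν) ^ (2 - 1) * 1)) s :=
    (((hasDerivAt_id s).sub_const ν).pow 2).const_mul (lam / 2)
  rw [h.deriv]
  norm_num
  ring

/-- One step of the recursion, with previous iterate `p`, current iterate `u`, next iterate `n`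
and perturbation `e`. -/
theorem momentum_correlation_step {η θ lam ν p u n e : ℝ}
    (hη : 0 < η) (hθ0 : 0 ≤ θ) (hθ1 : θ ≤ 1) (hlam : lam < 0) (hle : -(η * lam) ≤ 2)
    (hn : n = u + (1 - θ) * (u - p) - η * (lam * (u + (1 - θ) * (u - p) - ν) + e)) :
    (n - u) * (u - ν) ≥ (1 - θ) * (u - p) * (p - ν) + η / (2 * lam) * e ^ 2 := by
  have hμ : 0 < -(η * lam) := neg_pos.mpr (mul_neg_of_pos_of_neg hη hlam)
  have ha : 0 ≤ 1 - θ := sub_nonneg.mpr hθ1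
  have hcoef : 0 ≤ 1 - -(η * lam) * (1 - θ) / 2 := by nlinarith
  have hid : (n - u) * (u - ν) - ((1 - θ) * (u - p) * (p - ν) + η / (2 * lam) * e ^ 2) =
      -(η * lam) / 2 * (u - ν + e / lam) ^ 2
        + -(η * lam) / 2 * (u - ν + (1 - θ) * (u - p)) ^ 2
        + (1 - θ) * (1 - -(η * lam) * (1 - θ) / 2) * (u - p) ^ 2 := by
    rw [hn]
    field_simp [hlam.ne]
    ring
  have hnonneg : 0 ≤ -(η * lam) / 2 * (u - ν + e / lam) ^ 2
        + -(η * lam) / 2 * (u - ν + (1 - θ) * (u - p)) ^ 2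
        + (1 - θ) * (1 - -(η * lam) * (1 - θ) / 2) * (u - p) ^ 2 := by
    positivity
  linarith

/-- **Monotonicity of the momentum correlation along a negative-curvature direction.**
For the scalar inexact accelerated recursion on the quadratic `φ(s) = (λ/2)(s − ν)²`
with `−L̃ ≤ λ < −θ/η`, one has for every `k ≥ 0`:
`(x_{k+1} − x_k)(x_k − ν) ≥ (1−θ)(x_k − x_{k−1})(x_{k−1} − ν) + (η/(2λ))δ_k²`
(with the convention `x_{−1} = x_0`, encoded by truncated subtraction at `k = 0`). -/
theorem scalar_quadratic_momentum_correlation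
    (Ltil η θ lam ν : ℝ)
    (hL : 0 < Ltil) (hη0 : 0 < η) (hη : η ≤ 1 / (4 * Ltil))
    (hθ0 : 0 < θ) (hθ1 : θ < 1)
    (hlam_lb : -Ltil ≤ lam) (hlam_ub : lam < -(θ / η))
    (φ : ℝ → ℝ) (x w : ℕ → ℝ) (δ : ℕ → ℝ)
    (hφ : ∀ s : ℝ, φ s = lam / 2 * (s - ν) ^ 2)
    (hw0 : w 0 = x 0)
    (hw : ∀ k : ℕ, w (k + 1) = x (k + 1) + (1 - θ) * (x (k + 1) - x k))
    (hx : ∀ k : ℕ, x (k + 1) = w k - η * (deriv φ (w k) + δ k)) :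
    ∀ k : ℕ, (x (k + 1) - x k) * (x k - ν) ≥
      (1 - θ) * (x k - x (k - 1)) * (x (k - 1) - ν) + (η / (2 * lam)) * δ k ^ 2 := by
  have hlam : lam < 0 := hlam_ub.trans (neg_neg_of_pos (div_pos hθ0 hη0))
  have hle : -(η * lam) ≤ 2 := by
    rw [le_div_iff₀ (by positivity)] at hη
    nlinarith
  intro k
  have hxk := hx k
  rw [deriv_half_mul_sub_sq hφ] at hxk
  refine momentum_correlation_step hη0 hθ0.le hθ1.le hlam hle ?_
  cases k with
  | zero => simpa [hw0] using hxk
  | succ k => simpa only [hw, Nat.add_sub_cancel] using hxk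
end

section
/- Let Φ : E → ℝ be twice differentiable with L̃-Lipschitz gradient and ρ̃-Lipschitz Hessian (L̃, ρ̃ > 0). Let 0 < ε ≤ min{1, L̃²/ρ̃} and set η = 1/(4L̃), B = √(ε/ρ̃), θ = 4(ρ̃ε η²)^{1/4} (assume ε is small enough that θ ≤ 1), σ = ε², and let K be a natural number with K ≥ 1/θ. Let x : ℕ → E satisfy the inexact accelerated recursion below with inexactness level σ, and suppose that k·Σ_{i=0}^{k−1}‖x_{i+1} − x_i‖² ≤ B² for every k with 1 ≤ k ≤ K (the restart condition never triggers). Let K_0 be an index with ⌊K/2⌋ ≤ K_0 ≤ K−1 minimizing ‖x_{k+1} − x_k‖ over this range, and let ŵ = (1/(K_0+1))·Σ_{k=0}^{K_0} w_k. Then ‖∇Φ(ŵ)‖ ≤ 83ε. -/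
open Real Set Finset

/-- First-order Taylor bound for a map whose derivative is `ρ`-Lipschitz (without the sharp
factor `1/2`). -/
theorem norm_taylor_le_of_fderiv_lipschitz {E F : Type*} [NormedAddCommGroup E] [NormedSpace ℝ E]
    [NormedAddCommGroup F] [NormedSpace ℝ F] {g : E → F} {ρ : ℝ} (hρ : 0 ≤ ρ)
    (hg : Differentiable ℝ g)
    (hlip : ∀ x y : E, ‖fderiv ℝ g x - fderiv ℝ g y‖ ≤ ρ * ‖x - y‖) (y z : E) :
    ‖g y - g z - fderiv ℝ g z (y - z)‖ ≤ ρ * ‖y - z‖ ^ 2 := by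
  have h := (convex_segment (𝕜 := ℝ) z y).norm_image_sub_le_of_norm_fderiv_le' (f := g)
    (φ := fderiv ℝ g z) (C := ρ * ‖y - z‖) (x := z) (y := y) (fun v _ => hg v)
    (fun v hv => (hlip v z).trans (mul_le_mul_of_nonneg_left
      (norm_sub_le_of_mem_segment hv) hρ))
    (left_mem_segment ℝ z y) (right_mem_segment ℝ z y)
  calc _ ≤ ρ * ‖y - z‖ * ‖y - z‖ := h
    _ = _ := by ring

/-- The squared distances of finitely many points to their mean sum to at most the squared
distances to any other point. -/
theorem sum_norm_sub_mean_sq_le {E : Type*} [NormedAddCommGroup E] [InnerProductSpace ℝ E]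
    (n : ℕ) (w : ℕ → E) (m c : E) (hm : ∑ k ∈ Finset.range n, (w k - m) = 0) :
    ∑ k ∈ Finset.range n, ‖w k - m‖ ^ 2 ≤ ∑ k ∈ Finset.range n, ‖w k - c‖ ^ 2 := by
  have h : ∀ k, ‖w k - c‖ ^ 2
      = ‖w k - m‖ ^ 2 + 2 * inner ℝ (w k - m) (m - c) + ‖m - c‖ ^ 2 := by
    intro k
    rw [← norm_add_sq_real, sub_add_sub_cancel]
  simp only [h, Finset.sum_add_distrib, ← Finset.mul_sum, ← sum_inner, hm, inner_zero_left]
  have : 0 ≤ ∑ k ∈ Finset.range n, ‖m - c‖ ^ 2 := Finset.sum_nonneg fun _ _ => by positivity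
  linarith

/-- The value of a map with `ρ`-Lipschitz derivative at a mean of points, compared with the mean
of its values. -/
theorem norm_sum_sub_mean_le {E : Type*} [NormedAddCommGroup E] [InnerProductSpace ℝ E]
    {g : E → E} {ρ : ℝ} (hρ : 0 ≤ ρ) (hg : Differentiable ℝ g)
    (hlip : ∀ x y : E, ‖fderiv ℝ g x - fderiv ℝ g y‖ ≤ ρ * ‖x - y‖)
    (n : ℕ) (w : ℕ → E) (m c : E) (hm : ∑ k ∈ Finset.range n, (w k - m) = 0) :
    ‖∑ k ∈ Finset.range n, (g (w k) - g m)‖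
      ≤ ρ * ∑ k ∈ Finset.range n, ‖w k - c‖ ^ 2 := by
  have h : ∑ k ∈ Finset.range n, (g (w k) - g m)
      = ∑ k ∈ Finset.range n, (g (w k) - g m - fderiv ℝ g m (w k - m)) := by
    rw [Finset.sum_sub_distrib _ (fun k => fderiv ℝ g m (w k - m)), ← map_sum, hm, map_zero,
      sub_zero]
  rw [h]
  calc _ ≤ ∑ k ∈ Finset.range n, ρ * ‖w k - m‖ ^ 2 :=
        norm_sum_le_of_le _ fun k _ => norm_taylor_le_of_fderiv_lipschitz hρ hg hlip _ _
    _ = ρ * ∑ k ∈ Finset.range n, ‖w k - m‖ ^ 2 := by rw [Finset.mul_sum]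
    _ ≤ _ := mul_le_mul_of_nonneg_left (sum_norm_sub_mean_sq_le n w m c hm) hρ

/-- The displacement after `k` steps is controlled by the sum of squared steps. -/
theorem norm_sub_zero_sq_le {E : Type*} [NormedAddCommGroup E] (x : ℕ → E) (k : ℕ) :
    ‖x k - x 0‖ ^ 2 ≤ (k : ℝ) * ∑ i ∈ Finset.range k, ‖x (i + 1) - x i‖ ^ 2 := by
  rw [← Finset.sum_range_sub]
  calc _ ≤ (∑ i ∈ Finset.range k, ‖x (i + 1) - x i‖) ^ 2 := by
        gcongr; exact norm_sum_le _ _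
    _ ≤ _ := by
        simpa using sq_sum_le_card_mul_sum_sq (s := Finset.range k)
          (f := fun i => ‖x (i + 1) - x i‖)

/-- Telescoping of the steps of the accelerated recursion. -/
theorem smul_sum_accelerated_directions {E : Type*} [NormedAddCommGroup E] [NormedSpace ℝ E]
    {η θ : ℝ} {x w u : ℕ → E} (hw0 : w 0 = x 0)
    (hw : ∀ k : ℕ, w (k + 1) = x (k + 1) + (1 - θ) • (x (k + 1) - x k))
    (hx : ∀ k : ℕ, x (k + 1) = w k - η • u k) (n : ℕ) :
    η • ∑ k ∈ Finset.range (n + 1), u k = -((x (n + 1) - x n) + θ • (x n - x 0)) := by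
  have hu : ∀ k, η • u k = w k - x (k + 1) := fun k => by rw [hx k]; abel
  induction n with
  | zero => simp [hu, hw0]
  | succ n ih =>
    rw [Finset.sum_range_succ, smul_add, ih, hu, hw]
    module

/-- **Small gradient at the averaged output of a non-restarting epoch.**
With the parameter choices `η = 1/(4L̃)`, `B = √(ε/ρ̃)`, `θ = 4(ρ̃εη²)^{1/4} ≤ 1`,
`σ = ε²`, `K ≥ 1/θ`, if the restart condition never triggers during the `K` iterations,
and `K₀` minimizes `‖x_{k+1} − x_k‖` over `⌊K/2⌋ ≤ k ≤ K−1`, then the average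
`ŵ = (1/(K₀+1))·Σ_{k≤K₀} w_k` satisfies `‖∇Φ(ŵ)‖ ≤ 83ε`. -/
theorem last_epoch_output_small_gradient
    {E : Type*} [NormedAddCommGroup E] [InnerProductSpace ℝ E] [FiniteDimensional ℝ E]
    (Φ : E → ℝ) (Ltil ρtil : ℝ) (hL : 0 < Ltil) (hρ : 0 < ρtil)
    (hdiff : Differentiable ℝ Φ) (hdiff2 : Differentiable ℝ (gradient Φ))
    (hlip : LipschitzWith Ltil.toNNReal (gradient Φ))
    (hhess : ∀ x x' : E, ‖fderiv ℝ (gradient Φ) x - fderiv ℝ (gradient Φ) x'‖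
      ≤ ρtil * ‖x - x'‖)
    (ε η B θ σ : ℝ)
    (hε0 : 0 < ε) (hε1 : ε ≤ 1) (hε : ε ≤ Ltil ^ 2 / ρtil)
    (hη : η = 1 / (4 * Ltil))
    (hB : B = Real.sqrt (ε / ρtil))
    (hθ : θ = 4 * (ρtil * ε * η ^ 2) ^ ((1 : ℝ) / 4))
    (hθ1 : θ ≤ 1)
    (hσ : σ = ε ^ 2)
    (x w u : ℕ → E)
    (hw0 : w 0 = x 0)
    (hw : ∀ k : ℕ, w (k + 1) = x (k + 1) + (1 - θ) • (x (k + 1) - x k))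
    (hu : ∀ k : ℕ, ‖u k - gradient Φ (w k)‖ ≤ σ)
    (hx : ∀ k : ℕ, x (k + 1) = w k - η • u k)
    (K : ℕ) (hK1 : 1 ≤ K) (hKge : (1 : ℝ) / θ ≤ (K : ℝ))
    (hnotrigger : ∀ k : ℕ, 1 ≤ k → k ≤ K →
      (k : ℝ) * ∑ i ∈ Finset.range k, ‖x (i + 1) - x i‖ ^ 2 ≤ B ^ 2)
    (K₀ : ℕ) (hK₀lb : K / 2 ≤ K₀) (hK₀ub : K₀ ≤ K - 1)
    (hK₀min : ∀ k : ℕ, K / 2 ≤ k → k ≤ K - 1 →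
      ‖x (K₀ + 1) - x K₀‖ ≤ ‖x (k + 1) - x k‖)
    (what : E)
    (hwhat : what = ((K₀ : ℝ) + 1)⁻¹ • ∑ k ∈ Finset.range (K₀ + 1), w k) :
    ‖gradient Φ what‖ ≤ 83 * ε := by
  have hB0 : 0 ≤ B := hB ▸ Real.sqrt_nonneg _
  have hη0 : 0 < η := by rw [hη]; positivity
  have hθ0 : 0 < θ := by rw [hθ]; positivity
  have hB2 : ρtil * B ^ 2 = ε := by
    rw [hB, Real.sq_sqrt (by positivity)]; field_simp
  have hθ4 : θ ^ 4 = 256 * (ρtil * ε * η ^ 2) := by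
    rw [hθ, mul_pow, ← Real.rpow_natCast (_ ^ ((1 : ℝ) / 4)), ← Real.rpow_mul (by positivity)]
    norm_num
  have hθB : θ ^ 2 * B = 16 * ε * η := by
    rw [← sq_eq_sq₀ (by positivity) (by positivity)]
    calc (θ ^ 2 * B) ^ 2 = θ ^ 4 * B ^ 2 := by ring
      _ = 256 * ε * η ^ 2 * (ρtil * B ^ 2) := by rw [hθ4]; ring
      _ = _ := by rw [hB2]; ring
  have hKθ : 1 ≤ K * θ := by rwa [div_le_iff₀ hθ0] at hKge
  have hKpos : (0 : ℝ) < K := by exact_mod_cast hK1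
  have hdisp : ∀ k ≤ K, ‖x k - x 0‖ ≤ B := by
    intro k hk
    rcases Nat.eq_zero_or_pos k with rfl | hk0
    · simpa using hB0
    · exact (sq_le_sq₀ (norm_nonneg _) hB0).1
        ((norm_sub_zero_sq_le x k).trans (hnotrigger k hk0 hk))
  have hstep : ∀ k < K, ‖x (k + 1) - x k‖ ≤ B := by
    intro k hk
    refine (sq_le_sq₀ (norm_nonneg _) hB0).1 (le_trans ?_ (hnotrigger (k + 1) (by omega) hk))
    have h1 := Finset.single_le_sum (f := fun i => ‖x (i + 1) - x i‖ ^ 2)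
      (s := Finset.range (k + 1)) (fun i _ => by positivity) (Finset.self_mem_range_succ k)
    have h2 : (1 : ℝ) ≤ ((k + 1 : ℕ) : ℝ) := by exact_mod_cast Nat.succ_pos k
    exact h1.trans (le_mul_of_one_le_left (Finset.sum_nonneg fun i _ => by positivity) h2)
  have hwdist : ∀ k ∈ Finset.range (K₀ + 1), ‖w k - x 0‖ ^ 2 ≤ 4 * B ^ 2 := by
    intro k hk
    have hk' : k < K := by have := Finset.mem_range.1 hk; omega
    have : ‖w k - x 0‖ ≤ 2 * B := by
      cases k with
      | zero => simpa [hw0] using hB0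
      | succ k =>
        have h1 := hdisp (k + 1) hk'.le
        have h2 := hstep k (by omega)
        have h3 : ‖(1 - θ) • (x (k + 1) - x k)‖ ≤ B := by
          rw [norm_smul, Real.norm_of_nonneg (by linarith)]
          nlinarith [norm_nonneg (x (k + 1) - x k)]
        calc ‖w (k + 1) - x 0‖ = ‖(x (k + 1) - x 0) + (1 - θ) • (x (k + 1) - x k)‖ := by
              rw [hw]; congr 1; abel
          _ ≤ _ := norm_add_le _ _
          _ ≤ 2 * B := by linarith
    nlinarith [norm_nonneg (w k - x 0)]
  have hlast : ‖x (K₀ + 1) - x K₀‖ ≤ 1.42 * (B * θ) := by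
    have h1 : ((K - K / 2 : ℕ) : ℝ) * ‖x (K₀ + 1) - x K₀‖ ^ 2
        ≤ ∑ i ∈ Finset.range K, ‖x (i + 1) - x i‖ ^ 2 := by
      calc _ = ∑ i ∈ Finset.Ico (K / 2) K, ‖x (K₀ + 1) - x K₀‖ ^ 2 := by simp
        _ ≤ ∑ i ∈ Finset.Ico (K / 2) K, ‖x (i + 1) - x i‖ ^ 2 := by
            refine Finset.sum_le_sum fun i hi => ?_
            have hi' := Finset.mem_Ico.1 hi
            have := hK₀min i hi'.1 (by omega)
            gcongr
        _ ≤ _ := Finset.sum_le_sum_of_subset_of_nonneg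
            (fun i hi => by simp at hi ⊢; omega) (fun i _ _ => by positivity)
    have h2 : (K : ℝ) / 2 ≤ ((K - K / 2 : ℕ) : ℝ) := by
      rw [div_le_iff₀ two_pos]; exact_mod_cast (by omega : K ≤ (K - K / 2) * 2)
    have h3 : (K : ℝ) * ((K : ℝ) / 2 * ‖x (K₀ + 1) - x K₀‖ ^ 2) ≤ B ^ 2 := by
      refine le_trans ?_ (hnotrigger K hK1 le_rfl)
      gcongr
      exact le_trans (by gcongr) h1
    have h4 : (K * ‖x (K₀ + 1) - x K₀‖) ^ 2 ≤ (1.42 * B) ^ 2 := by nlinarith [sq_nonneg B]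
    have h5 : K * ‖x (K₀ + 1) - x K₀‖ ≤ 1.42 * B :=
      (sq_le_sq₀ (by positivity) (by positivity)).1 h4
    calc ‖x (K₀ + 1) - x K₀‖ ≤ (K * θ) * ‖x (K₀ + 1) - x K₀‖ :=
          le_mul_of_one_le_left (norm_nonneg _) hKθ
      _ = θ * (K * ‖x (K₀ + 1) - x K₀‖) := by ring
      _ ≤ θ * (1.42 * B) := by gcongr
      _ = _ := by ring
  set n : ℝ := (K₀ : ℝ) + 1 with hn
  have hn0 : 0 < n := by positivity
  have hnK : (K : ℝ) ≤ 2 * n := by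
    rw [hn]; exact_mod_cast (by omega : K ≤ 2 * (K₀ + 1))
  have hnθ : 1 ≤ 2 * n * θ := hKθ.trans (by gcongr)
  have hsumu : ‖∑ k ∈ Finset.range (K₀ + 1), u k‖ ≤ 77.44 * ε * n := by
    have h1 : η * ‖∑ k ∈ Finset.range (K₀ + 1), u k‖ ≤ 2.42 * (B * θ) := by
      calc _ = ‖η • ∑ k ∈ Finset.range (K₀ + 1), u k‖ := by
            rw [norm_smul, Real.norm_of_nonneg hη0.le]
        _ = ‖(x (K₀ + 1) - x K₀) + θ • (x K₀ - x 0)‖ := by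
            rw [smul_sum_accelerated_directions hw0 hw hx, norm_neg]
        _ ≤ ‖x (K₀ + 1) - x K₀‖ + θ * ‖x K₀ - x 0‖ := by
            refine (norm_add_le _ _).trans_eq ?_
            rw [norm_smul, Real.norm_of_nonneg hθ0.le]
        _ ≤ 1.42 * (B * θ) + θ * B := by
            gcongr; exact hdisp K₀ (by omega)
        _ = _ := by ring
    refine le_of_mul_le_mul_left (h1.trans ?_) hη0
    calc 2.42 * (B * θ) ≤ 2.42 * (B * θ) * (2 * n * θ) :=
          le_mul_of_one_le_right (by positivity) hnθ
      _ = 4.84 * n * (θ ^ 2 * B) := by ring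
      _ = η * (77.44 * ε * n) := by rw [hθB]; ring
  have herr : ‖∑ k ∈ Finset.range (K₀ + 1), (u k - gradient Φ (w k))‖ ≤ n * ε := by
    calc _ ≤ ∑ k ∈ Finset.range (K₀ + 1), ε := norm_sum_le_of_le _ fun k _ =>
          (hu k).trans (by rw [hσ]; nlinarith)
      _ = n * ε := by simp [hn]
  have hmean : ∑ k ∈ Finset.range (K₀ + 1), (w k - what) = 0 := by
    rw [Finset.sum_sub_distrib, Finset.sum_const, Finset.card_range, hwhat,
      ← Nat.cast_smul_eq_nsmul ℝ, smul_smul, Nat.cast_add_one, ← hn, mul_inv_cancel₀ hn0.ne',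
      one_smul, sub_self]
  have htaylor : ‖∑ k ∈ Finset.range (K₀ + 1), (gradient Φ (w k) - gradient Φ what)‖
      ≤ 4 * ε * n := by
    refine (norm_sum_sub_mean_le hρ.le hdiff2 hhess _ w what (x 0) hmean).trans ?_
    calc _ ≤ ρtil * ∑ k ∈ Finset.range (K₀ + 1), 4 * B ^ 2 := by
          gcongr with k hk; exact hwdist k hk
      _ = 4 * (ρtil * B ^ 2) * n := by simp [hn]; ring
      _ = _ := by rw [hB2]
  have hsplit : n • gradient Φ what = ∑ k ∈ Finset.range (K₀ + 1), u k
      - ∑ k ∈ Finset.range (K₀ + 1), (u k - gradient Φ (w k))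
      - ∑ k ∈ Finset.range (K₀ + 1), (gradient Φ (w k) - gradient Φ what) := by
    simp only [Finset.sum_sub_distrib, Finset.sum_const, Finset.card_range,
      ← Nat.cast_smul_eq_nsmul ℝ, Nat.cast_add_one, ← hn]
    abel
  have hfinal : n * ‖gradient Φ what‖ ≤ n * (83 * ε) := by
    calc _ = ‖n • gradient Φ what‖ := by rw [norm_smul, Real.norm_of_nonneg hn0.le]
      _ ≤ 77.44 * ε * n + n * ε + 4 * ε * n := by
          rw [hsplit]
          exact (norm_sub_le _ _).trans (add_le_add ((norm_sub_le _ _).trans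
            (add_le_add hsumu herr)) htaylor)
      _ ≤ _ := by nlinarith [mul_pos hn0 hε0]
  exact le_of_mul_le_mul_left hfinal hn0
end

section
/- Under the stated assumptions, suppose ‖y_prev − y*(w_prev)‖ ≤ σ/(2L̃) and ‖w − w_prev‖ ≤ 2B, and let y_T be the result of running accelerated gradient descent on the function y ↦ g(w, y) started at y_prev for T iterations with step size α = 1/ℓ and momentum β = (√κ − 1)/(√κ + 1), where T ≥ 2√κ · log( (2L̃√(κ+1)/σ) · (σ/(2L̃) + 2κB) ). Then ‖y_T − y*(w)‖ ≤ σ/(2L̃). -/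
open Real Set

noncomputable section

open scoped InnerProductSpace

section Gradient

variable {F : Type*} [NormedAddCommGroup F] [InnerProductSpace ℝ F] [CompleteSpace F]

lemma HasGradientAt.hasDerivAt_line {f : F → ℝ} {f' x d : F} {t : ℝ}
    (h : HasGradientAt f f' (x + t • d)) :
    HasDerivAt (fun s : ℝ => f (x + s • d)) ⟪f', d⟫_ℝ t := by
  have hl : HasDerivAt (fun s : ℝ => x + s • d) d t := by
    simpa using ((hasDerivAt_id t).smul_const d).const_add x
  exact (h.hasFDerivAt.comp_hasDerivAt t hl).congr_deriv (by simp)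

/-- The descent lemma for functions with Lipschitz gradient. -/
lemma le_add_inner_add_of_lipschitz_gradient_s17 {f : F → ℝ} {G : F → F} {ℓ : ℝ}
    (hG : ∀ x, HasGradientAt f (G x) x) (hL : ∀ x y, ‖G x - G y‖ ≤ ℓ * ‖x - y‖) (x d : F) :
    f (x + d) ≤ f x + ⟪G x, d⟫_ℝ + ℓ / 2 * ‖d‖ ^ 2 := by
  have hderiv : ∀ t : ℝ, HasDerivAt
      (fun s : ℝ => f (x + s • d) - s * ⟪G x, d⟫_ℝ - ℓ / 2 * ‖d‖ ^ 2 * s ^ 2)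
      (⟪G (x + t • d), d⟫_ℝ - ⟪G x, d⟫_ℝ - ℓ * ‖d‖ ^ 2 * t) t := by
    intro t
    have h1 := (hasDerivAt_id t).mul_const ⟪G x, d⟫_ℝ
    have h2 := (hasDerivAt_pow 2 t).const_mul (ℓ / 2 * ‖d‖ ^ 2)
    refine (((hG (x + t • d)).hasDerivAt_line.sub h1).sub h2).congr_deriv ?_
    simp
    ring
  have hanti := antitoneOn_of_deriv_nonpos (convex_Icc (0 : ℝ) 1)
    (fun t _ => (hderiv t).continuousAt.continuousWithinAt)
    (fun t _ => (hderiv t).differentiableAt.differentiableWithinAt) (by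
      intro t ht
      rw [interior_Icc] at ht
      rw [(hderiv t).deriv, ← inner_sub_left]
      have h1 := real_inner_le_norm (G (x + t • d) - G x) d
      have h2 := hL (x + t • d) x
      rw [add_sub_cancel_left, norm_smul, Real.norm_of_nonneg ht.1.le] at h2
      nlinarith [mul_le_mul_of_nonneg_right h2 (norm_nonneg d)])
  have h := hanti (left_mem_Icc.2 zero_le_one) (right_mem_Icc.2 zero_le_one) zero_le_one
  simp only [one_smul, zero_smul, add_zero] at h
  linarith

/-- The first-order lower bound for strongly convex functions. -/
lemma add_inner_add_le_of_strongConvex {f : F → ℝ} {f' : F} {μ : ℝ}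
    (hsc : ConvexOn ℝ univ (fun y => f y - μ / 2 * ‖y‖ ^ 2)) {x : F}
    (hf : HasGradientAt f f' x) (y : F) :
    f x + ⟪f', y - x⟫_ℝ + μ / 2 * ‖y - x‖ ^ 2 ≤ f y := by
  set d := y - x with hd
  have hy : y = x + d := by simp [hd]
  have hquad : ∀ s : ℝ, ‖x + s • d‖ ^ 2 = ‖x‖ ^ 2 + 2 * s * ⟪x, d⟫_ℝ + s ^ 2 * ‖d‖ ^ 2 := by
    intro s
    rw [norm_add_sq_real, inner_smul_right, norm_smul, mul_pow, Real.norm_eq_abs, sq_abs]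
    ring
  have hconv : ConvexOn ℝ univ
      (fun s : ℝ => f (x + s • d) - μ / 2 * ‖x + s • d‖ ^ 2) := by
    have h := hsc.comp_affineMap (AffineMap.lineMap x y)
    simpa [Function.comp_def, AffineMap.lineMap_apply, ← hd, add_comm] using h
  have hderiv : HasDerivAt (fun s : ℝ => f (x + s • d) - μ / 2 * ‖x + s • d‖ ^ 2)
      (⟪f', d⟫_ℝ - μ * ⟪x, d⟫_ℝ) 0 := by
    have h0 : HasGradientAt f f' (x + (0 : ℝ) • d) := by simpa using hf
    simp only [hquad]
    have h1 : HasDerivAt (fun s : ℝ => ‖x‖ ^ 2 + 2 * s * ⟪x, d⟫_ℝ + s ^ 2 * ‖d‖ ^ 2)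
        (2 * ⟪x, d⟫_ℝ) 0 := by
      have h2 := ((((hasDerivAt_id (0 : ℝ)).const_mul 2).mul_const ⟪x, d⟫_ℝ).const_add
        (‖x‖ ^ 2)).add ((hasDerivAt_pow 2 (0 : ℝ)).mul_const (‖d‖ ^ 2))
      exact h2.congr_deriv (by simp)
    exact (h0.hasDerivAt_line.sub (h1.const_mul (μ / 2))).congr_deriv (by ring)
  have h := hconv.le_slope_of_hasDerivAt (mem_univ 0) (mem_univ 1) zero_lt_one hderiv
  have hq := hquad 1
  simp only [slope_def_field, sub_zero, div_one, one_smul, zero_smul, add_zero] at h hq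
  rw [hq] at h
  rw [hy]
  linarith

lemma HasGradientAt.eq_zero_of_forall_le {f : F → ℝ} {f' x : F} (hf : HasGradientAt f f' x)
    (hmin : ∀ y, f x ≤ f y) : f' = 0 := by
  have h := IsLocalMin.hasFDerivAt_eq_zero (Filter.Eventually.of_forall hmin) hf.hasFDerivAt
  simpa using h

/-- One step of accelerated gradient descent contracts the Lyapunov function
`f x - f x⋆ + μ / 2 * ‖v - x⋆‖ ^ 2`, where `v = y + s • (y - x)` and `s = √κ`. -/
lemma agd_lyapunov_step {f : F → ℝ} {G : F → F} {μ s : ℝ} (hμ : 0 < μ) (hs : 1 ≤ s)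
    (hG : ∀ x, HasGradientAt f (G x) x) (hL : ∀ x y, ‖G x - G y‖ ≤ μ * s ^ 2 * ‖x - y‖)
    (hsc : ConvexOn ℝ univ (fun y => f y - μ / 2 * ‖y‖ ^ 2)) (x y x' xs : F)
    (hx' : x' = y - (1 / (μ * s ^ 2)) • G y) :
    f x' - f xs + μ / 2 * ‖x + s • (x' - x) - xs‖ ^ 2 ≤
      (1 - 1 / s) * (f x - f xs + μ / 2 * ‖y + s • (y - x) - xs‖ ^ 2) := by
  have hs0 : 0 < s := by linarith
  have hA := le_add_inner_add_of_lipschitz_gradient_s17 hG hL y (-((1 / (μ * s ^ 2)) • G y))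
  have hB := add_inner_add_le_of_strongConvex hsc (hG y) xs
  have hC := add_inner_add_le_of_strongConvex hsc (hG y) x
  rw [← sub_eq_add_neg, ← hx', inner_neg_right, inner_smul_right, real_inner_self_eq_norm_sq,
    norm_neg, norm_smul, mul_pow, Real.norm_eq_abs, sq_abs] at hA
  obtain ⟨p, rfl⟩ : ∃ p, xs = y - p := ⟨y - xs, by simp⟩
  obtain ⟨d, rfl⟩ : ∃ d, x = y - d := ⟨y - x, by simp⟩
  have e1 : y - d + s • (x' - (y - d)) - (y - p) =
      p + (s - 1) • d - (1 / (μ * s)) • G y := by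
    have : s * (1 / (μ * s ^ 2)) = 1 / (μ * s) := by field_simp
    rw [hx', ← this]
    module
  have e2 : y + s • (y - (y - d)) - (y - p) = p + s • d := by module
  have n1 : ‖p + (s - 1) • d - (1 / (μ * s)) • G y‖ ^ 2 =
      ‖p‖ ^ 2 + (s - 1) ^ 2 * ‖d‖ ^ 2 + (1 / (μ * s)) ^ 2 * ‖G y‖ ^ 2 +
        2 * (s - 1) * ⟪p, d⟫_ℝ - 2 * (1 / (μ * s)) * ⟪G y, p⟫_ℝ -
        2 * (s - 1) * (1 / (μ * s)) * ⟪G y, d⟫_ℝ := by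
    rw [norm_sub_sq_real, norm_add_sq_real, inner_add_left]
    simp only [inner_smul_right, norm_smul, mul_pow, Real.norm_eq_abs, sq_abs,
      real_inner_comm (G y)]
    ring
  have n2 : ‖p + s • d‖ ^ 2 = ‖p‖ ^ 2 + s ^ 2 * ‖d‖ ^ 2 + 2 * s * ⟪p, d⟫_ℝ := by
    rw [norm_add_sq_real]
    simp only [inner_smul_right, norm_smul, mul_pow, Real.norm_eq_abs, sq_abs]
    ring
  rw [e1, e2, n1, n2]
  simp only [sub_sub_cancel_left, inner_neg_right, norm_neg] at hB hC
  have hq0 : 0 ≤ 1 / s := by positivity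
  have hq1 : 0 ≤ 1 - 1 / s := by
    rw [sub_nonneg, div_le_one hs0]
    exact hs
  have hB' := mul_le_mul_of_nonneg_left hB hq0
  have hC' := mul_le_mul_of_nonneg_left hC hq1
  have hslack : 0 ≤ (s - 1) * (μ / 2 * ‖d‖ ^ 2) + (1 - 1 / s) * (μ / 2 * ‖d‖ ^ 2) := by
    have : 0 ≤ s - 1 := by linarith
    positivity
  refine le_of_sub_nonneg (le_of_le_of_eq
    (add_nonneg (add_nonneg (add_nonneg (sub_nonneg.2 hA) (sub_nonneg.2 hB'))
      (sub_nonneg.2 hC')) hslack) ?_)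
  field_simp
  ring

/-- Linear convergence of accelerated gradient descent to the minimizer. -/
lemma agd_norm_sq_le {f : F → ℝ} {G : F → F} {μ s : ℝ} (hμ : 0 < μ) (hs : 1 ≤ s)
    (hG : ∀ x, HasGradientAt f (G x) x) (hL : ∀ x y, ‖G x - G y‖ ≤ μ * s ^ 2 * ‖x - y‖)
    (hsc : ConvexOn ℝ univ (fun y => f y - μ / 2 * ‖y‖ ^ 2)) {xs : F} (hmin : ∀ y, f xs ≤ f y)
    {z zt : ℕ → F} (h0 : zt 0 = z 0)
    (hstep : ∀ t, z (t + 1) = zt t - (1 / (μ * s ^ 2)) • G (zt t))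
    (hmom : ∀ t, zt (t + 1) = z (t + 1) + ((s - 1) / (s + 1)) • (z (t + 1) - z t)) (T : ℕ) :
    ‖z T - xs‖ ^ 2 ≤ (s ^ 2 + 1) * (1 - 1 / s) ^ T * ‖z 0 - xs‖ ^ 2 := by
  have hq1 : 0 ≤ 1 - 1 / s := by
    rw [sub_nonneg, div_le_one (by linarith)]
    exact hs
  have hGs : G xs = 0 := (hG xs).eq_zero_of_forall_le hmin
  have hV : ∀ t, f (z t) - f xs + μ / 2 * ‖zt t + s • (zt t - z t) - xs‖ ^ 2 ≤
      (1 - 1 / s) ^ t * (μ / 2 * (s ^ 2 + 1) * ‖z 0 - xs‖ ^ 2) := by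
    intro t
    induction t with
    | zero =>
      have h := le_add_inner_add_of_lipschitz_gradient_s17 hG hL xs (z 0 - xs)
      simp only [hGs, inner_zero_left, add_sub_cancel] at h
      simp only [h0, sub_self, smul_zero, add_zero, pow_zero, one_mul]
      linarith
    | succ t ih =>
      have h := agd_lyapunov_step hμ hs hG hL hsc (z t) (zt t) (z (t + 1)) xs (hstep t)
      have e : zt (t + 1) + s • (zt (t + 1) - z (t + 1)) = z t + s • (z (t + 1) - z t) := by
        have hc : (1 + s) * ((s - 1) / (s + 1)) = s - 1 := by
          have : s + 1 ≠ 0 := by linarith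
          field_simp
          ring
        have : zt (t + 1) + s • (zt (t + 1) - z (t + 1)) =
            z (t + 1) + ((1 + s) * ((s - 1) / (s + 1))) • (z (t + 1) - z t) := by
          rw [hmom t]
          module
        rw [this, hc]
        module
      rw [e, pow_succ' (1 - 1 / s), mul_assoc]
      exact h.trans (mul_le_mul_of_nonneg_left ih hq1)
  have hlow := add_inner_add_le_of_strongConvex hsc (hG xs) (z T)
  rw [hGs, inner_zero_left] at hlow
  have hn : 0 ≤ μ / 2 * ‖zt T + s • (zt T - z T) - xs‖ ^ 2 := by positivity
  have hμ2 : 0 < μ / 2 := by positivity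
  refine le_of_mul_le_mul_left ?_ hμ2
  linarith [hV T]

/-- The gradient of a strongly convex function bounds the distance to its minimizer. -/
lemma mul_norm_sub_minimizer_le {f : F → ℝ} {G : F → F} {μ : ℝ}
    (hG : ∀ x, HasGradientAt f (G x) x)
    (hsc : ConvexOn ℝ univ (fun y => f y - μ / 2 * ‖y‖ ^ 2)) {xs : F} (hmin : ∀ y, f xs ≤ f y)
    (y : F) : μ * ‖y - xs‖ ≤ ‖G y‖ := by
  have h1 := add_inner_add_le_of_strongConvex hsc (hG xs) y
  have h2 := add_inner_add_le_of_strongConvex hsc (hG y) xs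
  rw [(hG xs).eq_zero_of_forall_le hmin, inner_zero_left] at h1
  rw [← neg_sub y xs, inner_neg_right, norm_neg] at h2
  have h3 := real_inner_le_norm (G y) (y - xs)
  rcases (norm_nonneg (y - xs)).eq_or_lt with h | h
  · rw [← h, mul_zero]
    exact norm_nonneg _
  · refine le_of_mul_le_mul_right ?_ h
    linarith

end Gradient

section Product

variable {E F : Type*} [NormedAddCommGroup E] [InnerProductSpace ℝ E] [CompleteSpace E]
  [NormedAddCommGroup F] [InnerProductSpace ℝ F] [CompleteSpace F]

lemma HasGradientAt.comp_pmk_right {g : WithLp 2 (E × F) → ℝ} {g' : WithLp 2 (E × F)} {x : E} {y : F}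
    (h : HasGradientAt g g' (pmk x y)) :
    HasGradientAt (fun y => g (pmk x y)) g'.snd y := by
  have hp : HasFDerivAt (fun y : F => pmk x y)
      ((WithLp.prodContinuousLinearEquiv 2 ℝ E F).symm.toContinuousLinearMap.comp
        (ContinuousLinearMap.inr ℝ E F)) y :=
    (WithLp.prodContinuousLinearEquiv 2 ℝ E F).symm.hasFDerivAt.comp y
      (hasFDerivAt_prodMk_right x y)
  rw [hasGradientAt_iff_hasFDerivAt]
  refine (h.hasFDerivAt.comp y hp).congr_fderiv ?_
  ext d
  simp [WithLp.prod_inner_apply]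

end Product

/-- The number of steps after which `√(κ + 1) (1 - 1 / s) ^ (T / 2) D` drops below `r`. -/
lemma le_of_sq_le_of_log_le {s D r a : ℝ} (hs : 1 ≤ s) (hD : 0 < D) (hr : 0 < r) {T : ℕ}
    (ha : a ^ 2 ≤ (s ^ 2 + 1) * (1 - 1 / s) ^ T * D ^ 2)
    (hT : 2 * s * Real.log (√(s ^ 2 + 1) / r * D) ≤ T) : a ≤ r := by
  have hs0 : 0 < s := by linarith
  have hq1 : 0 ≤ 1 - 1 / s := by
    rw [sub_nonneg, div_le_one hs0]
    exact hs
  have hpow : (1 - 1 / s) ^ T ≤ Real.exp (-(T / s)) := by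
    calc (1 - 1 / s) ^ T ≤ Real.exp (-(1 / s)) ^ T :=
          pow_le_pow_left₀ hq1 (Real.one_sub_le_exp_neg _) T
      _ = Real.exp (-(T / s)) := by
          rw [← Real.exp_nat_mul]
          ring_nf
  have hX : 0 < √(s ^ 2 + 1) / r * D := by positivity
  have hle : Real.exp (-(T / s)) ≤ ((√(s ^ 2 + 1) / r * D) ^ 2)⁻¹ := by
    rw [← Real.exp_log (inv_pos.2 (pow_pos hX 2)), Real.exp_le_exp, Real.log_inv, Real.log_pow,
      neg_le_neg_iff, le_div_iff₀ hs0]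
    push_cast
    linarith
  refine le_of_sq_le_sq ?_ hr.le
  calc a ^ 2 ≤ (s ^ 2 + 1) * ((√(s ^ 2 + 1) / r * D) ^ 2)⁻¹ * D ^ 2 :=
        ha.trans (by gcongr; exact hpow.trans hle)
    _ = r ^ 2 := by
        rw [mul_pow, div_pow, Real.sq_sqrt (by positivity)]
        field_simp

/-- **Warm-started AGD keeps the lower-level error small.**
If `‖y_prev − y*(w_prev)‖ ≤ σ/(2L̃)` and `‖w − w_prev‖ ≤ 2B`, then running AGD on
`y ↦ g(w, y)` from `y_prev` with `α = 1/ℓ`, `β = (√κ − 1)/(√κ + 1)` for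
`T ≥ 2√κ·log((2L̃√(κ+1)/σ)(σ/(2L̃) + 2κB))` steps yields `‖y_T − y*(w)‖ ≤ σ/(2L̃)`. -/
theorem agd_warm_start
    {E F : Type*}
    [NormedAddCommGroup E] [InnerProductSpace ℝ E] [FiniteDimensional ℝ E]
    [NormedAddCommGroup F] [InnerProductSpace ℝ F] [FiniteDimensional ℝ F]
    (g : WithLp 2 (E × F) → ℝ) (ℓ μ : ℝ) (hμ : 0 < μ) (hμℓ : μ ≤ ℓ)
    (hdiff : Differentiable ℝ g)
    (hlip : LipschitzWith ℓ.toNNReal (gradient g))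
    (hsc : ∀ x : E, ConvexOn ℝ Set.univ (fun y : F => g (pmk x y) - μ / 2 * ‖y‖ ^ 2))
    (ystar : E → F)
    (hmin : ∀ x : E, ∀ y : F, g (pmk x (ystar x)) ≤ g (pmk x y))
    (κ : ℝ) (hκ : κ = ℓ / μ)
    (Ltil σ B : ℝ) (hLtil : 0 < Ltil) (hσ : 0 < σ) (hB : 0 < B)
    (w wprev : E) (yprev : F)
    (hyprev : ‖yprev - ystar wprev‖ ≤ σ / (2 * Ltil))
    (hww : ‖w - wprev‖ ≤ 2 * B)
    (α β : ℝ) (hα : α = 1 / ℓ) (hβ : β = (Real.sqrt κ - 1) / (Real.sqrt κ + 1))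
    (z ztilde : ℕ → F)
    (hz0 : z 0 = yprev) (hzt0 : ztilde 0 = z 0)
    (hstep : ∀ t : ℕ, z (t + 1) =
      ztilde t - α • gradient (fun y : F => g (pmk w y)) (ztilde t))
    (hmom : ∀ t : ℕ, ztilde (t + 1) = z (t + 1) + β • (z (t + 1) - z t))
    (T : ℕ)
    (hT : 2 * Real.sqrt κ *
        Real.log ((2 * Ltil * Real.sqrt (κ + 1) / σ) * (σ / (2 * Ltil) + 2 * κ * B))
      ≤ (T : ℝ)) :
    ‖z T - ystar w‖ ≤ σ / (2 * Ltil) := by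
  have hℓ : 0 < ℓ := hμ.trans_le hμℓ
  have hκ1 : 1 ≤ κ := by rwa [hκ, le_div_iff₀ hμ, one_mul]
  have hs : 1 ≤ √κ := Real.one_le_sqrt.2 hκ1
  have hs2 : √κ ^ 2 = κ := Real.sq_sqrt (by linarith)
  have hμs : μ * √κ ^ 2 = ℓ := by
    rw [hs2, hκ]
    field_simp
  have hG : ∀ x y, HasGradientAt (fun y => g (pmk x y)) (gradient g (pmk x y)).snd y :=
    fun x y => (hdiff (pmk x y)).hasGradientAt.comp_pmk_right
  have hGL : ∀ p q, ‖(gradient g p).snd - (gradient g q).snd‖ ≤ ℓ * ‖p - q‖ := by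
    intro p q
    have h := hlip.norm_sub_le p q
    rw [Real.coe_toNNReal _ hℓ.le] at h
    exact (WithLp.norm_snd_le _ (gradient g p - gradient g q)).trans h
  have hL : ∀ y y', ‖(gradient g (pmk w y)).snd - (gradient g (pmk w y')).snd‖ ≤
      μ * √κ ^ 2 * ‖y - y'‖ := by
    intro y y'
    have e : ‖pmk w y - pmk w y'‖ = ‖y - y'‖ := by
      rw [← sq_eq_sq₀ (norm_nonneg _) (norm_nonneg _), WithLp.prod_norm_sq_eq_of_L2]
      change ‖w - w‖ ^ 2 + ‖y - y'‖ ^ 2 = _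
      simp
    rw [hμs, ← e]
    exact hGL _ _
  have hshift : ‖ystar wprev - ystar w‖ ≤ 2 * κ * B := by
    have h1 := mul_norm_sub_minimizer_le (hG w) (hsc w) (hmin w) (ystar wprev)
    have h2 := hGL (pmk w (ystar wprev)) (pmk wprev (ystar wprev))
    have e : ‖pmk w (ystar wprev) - pmk wprev (ystar wprev)‖ = ‖w - wprev‖ := by
      rw [← sq_eq_sq₀ (norm_nonneg _) (norm_nonneg _), WithLp.prod_norm_sq_eq_of_L2]
      change ‖w - wprev‖ ^ 2 + ‖ystar wprev - ystar wprev‖ ^ 2 = _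
      simp
    rw [(hG wprev (ystar wprev)).eq_zero_of_forall_le (hmin wprev), sub_zero, e] at h2
    have h3 : μ * ‖ystar wprev - ystar w‖ ≤ ℓ * (2 * B) :=
      h1.trans (h2.trans (mul_le_mul_of_nonneg_left hww hℓ.le))
    refine le_of_mul_le_mul_left (h3.trans_eq ?_) hμ
    rw [hκ]
    field_simp
  have hD : ‖z 0 - ystar w‖ ≤ σ / (2 * Ltil) + 2 * κ * B := by
    rw [hz0, ← sub_add_sub_cancel yprev (ystar wprev)]
    exact (norm_add_le _ _).trans (add_le_add hyprev hshift)
  have hrate := agd_norm_sq_le hμ hs (hG w) hL (hsc w) (hmin w) hzt0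
    (fun t => by rw [hstep t, hα, hμs, (hG w (ztilde t)).gradient])
    (fun t => by rw [hmom t, hβ]) T
  have hq1 : 0 ≤ 1 - 1 / √κ := by
    rw [sub_nonneg, div_le_one (by linarith)]
    exact hs
  refine le_of_sq_le_of_log_le hs (D := σ / (2 * Ltil) + 2 * κ * B) (by positivity)
    (by positivity) (hrate.trans (by gcongr)) (le_of_eq_of_le ?_ hT)
  rw [hs2]
  congr 3
  field_simp
end
end

section
/- Under the stated assumptions, the function Φ̄(x) = max_{y ∈ F} f̄(x,y) = f̄(x, y*(x)) is differentiable with (κ+1)ℓ-Lipschitz gradient, and twice differentiable with 4√2·κ³·ρ-Lipschitz Hessian (in operator norm), where κ = ℓ/μ. -/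
open Real Set

noncomputable section

section Calculus

variable {V W : Type*} [NormedAddCommGroup V] [InnerProductSpace ℝ V]
  [NormedAddCommGroup W] [InnerProductSpace ℝ W]

/-- The Fréchet derivative of a convex function is monotone. -/
theorem ConvexOn.hasFDerivAt_apply_le {f : V → ℝ} (hf : ConvexOn ℝ univ f) {a b : V}
    {f'a f'b : V →L[ℝ] ℝ} (ha : HasFDerivAt f f'a a) (hb : HasFDerivAt f f'b b) :
    f'a (b - a) ≤ f'b (b - a) := by
  have hline : ConvexOn ℝ univ (f ∘ AffineMap.lineMap (k := ℝ) a b) := by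
    simpa using hf.comp_affineMap (AffineMap.lineMap (k := ℝ) a b)
  have h0 : HasDerivAt (f ∘ AffineMap.lineMap (k := ℝ) a b) (f'a (b - a)) 0 :=
    HasFDerivAt.comp_hasDerivAt (0 : ℝ) (by simpa using ha) AffineMap.hasDerivAt_lineMap
  have h1 : HasDerivAt (f ∘ AffineMap.lineMap (k := ℝ) a b) (f'b (b - a)) 1 :=
    HasFDerivAt.comp_hasDerivAt (1 : ℝ) (by simpa using hb) AffineMap.hasDerivAt_lineMap
  exact (hline.le_slope_of_hasDerivAt (mem_univ _) (mem_univ _) zero_lt_one h0).trans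
    (hline.slope_le_of_hasDerivAt (mem_univ _) (mem_univ _) zero_lt_one h1)

/-- An expansion lower bound on a map passes to its derivative. -/
theorem HasFDerivAt.mul_norm_le_of_mul_norm_sub_le {T : V → W} {T' : V →L[ℝ] W} {y : V} {c : ℝ}
    (hT : HasFDerivAt T T' y) (h : ∀ y', c * ‖y' - y‖ ≤ ‖T y' - T y‖) (w : V) :
    c * ‖w‖ ≤ ‖T' w‖ := by
  have hlim := (hT.lim w (c := fun t : ℝ => t) (l := Filter.atTop)
    (by simpa using Filter.tendsto_abs_atTop_atTop)).norm
  refine ge_of_tendsto hlim ?_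
  filter_upwards [Filter.eventually_gt_atTop 0] with t ht
  have := h (y + t⁻¹ • w)
  rw [add_sub_cancel_left, norm_smul, norm_inv, Real.norm_of_nonneg ht.le] at this
  rw [norm_smul, Real.norm_of_nonneg ht.le]
  calc c * ‖w‖ = t * (c * (t⁻¹ * ‖w‖)) := by field_simp
    _ ≤ _ := mul_le_mul_of_nonneg_left this ht.le

/-- The derivative of a gradient is symmetric. -/
theorem inner_fderiv_gradient_comm [CompleteSpace V] {f : V → ℝ} (hf : Differentiable ℝ f)
    {p : V} (hg : DifferentiableAt ℝ (gradient f) p) (u v : V) :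
    inner ℝ (fderiv ℝ (gradient f) p u) v = inner ℝ u (fderiv ℝ (gradient f) p v) := by
  have h1 : ∀ q, HasFDerivAt f (innerSL ℝ (gradient f q)) q :=
    fun q => (hf q).hasGradientAt.hasFDerivAt
  have h2 : HasFDerivAt (fun q => innerSL ℝ (gradient f q))
      ((innerSL ℝ (E := V) : V →L[ℝ] V →L[ℝ] ℝ) ∘L fderiv ℝ (gradient f) p) p :=
    (innerSL ℝ (E := V) : V →L[ℝ] V →L[ℝ] ℝ).hasFDerivAt.comp p hg.hasFDerivAt
  have h3 := second_derivative_symmetric h1 h2 u v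
  rw [real_inner_comm _ u]
  exact h3

end Calculus

section L2Norm

variable {E F : Type*} [NormedAddCommGroup E] [NormedAddCommGroup F]

theorem pmk_sub_pmk (x x' : E) (y y' : F) : pmk x y - pmk x' y' = pmk (x - x') (y - y') := rfl

theorem norm_pmk_sq (x : E) (y : F) : ‖pmk x y‖ ^ 2 = ‖x‖ ^ 2 + ‖y‖ ^ 2 :=
  WithLp.prod_norm_sq_eq_of_L2 _

theorem norm_pmk_le {x : E} {y : F} {K : ℝ} (h : ‖y‖ ≤ K * ‖x‖) :
    ‖pmk x y‖ ≤ √(1 + K ^ 2) * ‖x‖ := by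
  refine (sq_le_sq₀ (norm_nonneg _) (by positivity)).1 ?_
  rw [norm_pmk_sq, mul_pow, Real.sq_sqrt (by positivity)]
  nlinarith [pow_le_pow_left₀ (norm_nonneg y) h 2]

end L2Norm

section L2Product

variable {V E F : Type*} [NormedAddCommGroup V] [NormedSpace ℝ V]
  [NormedAddCommGroup E] [InnerProductSpace ℝ E]
  [NormedAddCommGroup F] [InnerProductSpace ℝ F]

/-- The continuous linear map `v ↦ (A v, B v)` into the `ℓ²` product. -/
def pmkL (A : V →L[ℝ] E) (B : V →L[ℝ] F) : V →L[ℝ] WithLp 2 (E × F) :=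
  (WithLp.prodContinuousLinearEquiv 2 ℝ E F).symm.toContinuousLinearMap ∘L A.prod B

theorem HasFDerivAt.pmk {a : V → E} {b : V → F} {a' : V →L[ℝ] E} {b' : V →L[ℝ] F} {v : V}
    (ha : HasFDerivAt a a' v) (hb : HasFDerivAt b b' v) :
    HasFDerivAt (fun v => _root_.pmk (a v) (b v)) (pmkL a' b') v :=
  (WithLp.prodContinuousLinearEquiv 2 ℝ E F).symm.toContinuousLinearMap.hasFDerivAt.comp v
    (ha.prodMk hb)

theorem inner_pmk (p : WithLp 2 (E × F)) (x : E) (y : F) :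
    inner ℝ p (pmk x y) = inner ℝ p.fst x + inner ℝ p.snd y := rfl

/-- An implicit function whose increments are `O(x' - x)` is differentiable
wherever the partial derivative in the implicit variable is bounded below. -/
theorem exists_hasFDerivAt_of_implicit [FiniteDimensional ℝ F]
    {G : WithLp 2 (E × F) → F} {ys : E → F} {x : E} {c K : ℝ} (hc : 0 < c)
    (hG : DifferentiableAt ℝ G (pmk x (ys x))) (hzero : ∀ x', G (pmk x' (ys x')) = 0)
    (hys : ∀ x', ‖ys x' - ys x‖ ≤ K * ‖x' - x‖)
    (hbelow : ∀ w : F, c * ‖w‖ ≤ ‖fderiv ℝ G (pmk x (ys x)) (pmk 0 w)‖) :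
    ∃ J : E →L[ℝ] F, HasFDerivAt ys J x ∧
      ∀ v, fderiv ℝ G (pmk x (ys x)) (pmk v (J v)) = 0 := by
  set H := fderiv ℝ G (pmk x (ys x)) with hH
  let Hy : F →L[ℝ] F := H ∘L pmkL 0 (.id ℝ F)
  let Hx : E →L[ℝ] F := H ∘L pmkL (.id ℝ E) 0
  have hsplit : ∀ v w, H (pmk v w) = Hx v + Hy w := fun v w => by
    change H (pmk v w) = H (pmk v 0) + H (pmk 0 w)
    rw [← map_add]
    congr 1
    apply WithLp.ofLp_injective
    simp
  have hinj : Function.Injective Hy.toLinearMap := by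
    rw [← LinearMap.ker_eq_bot, LinearMap.ker_eq_bot']
    intro w hw
    have h1 := hbelow w
    have h2 : H (pmk 0 w) = 0 := hw
    rw [h2, norm_zero] at h1
    exact norm_le_zero_iff.1 (nonpos_of_mul_nonpos_right h1 hc)
  let e := (LinearEquiv.ofInjectiveEndo Hy.toLinearMap hinj).toContinuousLinearEquiv
  let J : E →L[ℝ] F := -(e.symm.toContinuousLinearMap ∘L Hx)
  have hJ : ∀ v, H (pmk v (J v)) = 0 := fun v => by
    have h1 : Hy (e.symm (Hx v)) = Hx v := e.apply_symm_apply (Hx v)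
    have h2 : J v = -e.symm (Hx v) := rfl
    rw [hsplit, h2, map_neg, h1, add_neg_cancel]
  refine ⟨J, .of_isLittleO ?_, hJ⟩
  have hO : (fun x' => pmk x' (ys x') - pmk x (ys x)) =O[nhds x] fun x' => x' - x := by
    refine Asymptotics.IsBigO.of_bound √(1 + K ^ 2) (.of_forall fun x' => ?_)
    rw [pmk_sub_pmk]
    exact norm_pmk_le (hys x')
  have hcont : Filter.Tendsto (fun x' => pmk x' (ys x')) (nhds x) (nhds (pmk x (ys x))) := by
    rw [← tendsto_sub_nhds_zero_iff]
    exact hO.trans_tendsto (tendsto_sub_nhds_zero_iff.2 Filter.tendsto_id)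
  have ho := (hG.hasFDerivAt.isLittleO.comp_tendsto hcont).trans_isBigO hO
  refine Asymptotics.IsBigO.trans_isLittleO (.of_bound c⁻¹ (.of_forall fun x' => ?_)) ho
  have h1 : H (pmk x' (ys x') - pmk x (ys x)) = H (pmk 0 (ys x' - ys x - J (x' - x))) := by
    have h2 := hJ (x' - x)
    rw [hsplit] at h2
    rw [pmk_sub_pmk, hsplit, hsplit, map_sub Hy _ (J _), map_zero, zero_add,
      eq_neg_of_add_eq_zero_left h2]
    abel
  simp only [Function.comp_apply, hzero, ← hH, h1, sub_zero, zero_sub, norm_neg]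
  rw [← div_eq_inv_mul, le_div_iff₀' hc]
  exact hbelow _

end L2Product

section Minimax

variable {E F : Type*}
  [NormedAddCommGroup E] [InnerProductSpace ℝ E] [FiniteDimensional ℝ E]
  [NormedAddCommGroup F] [InnerProductSpace ℝ F] [FiniteDimensional ℝ F]
  {fb : WithLp 2 (E × F) → ℝ} {μ ℓ : ℝ}

theorem hasFDerivAt_partial_snd (hdiff : Differentiable ℝ fb) (x : E) (y : F) :
    HasFDerivAt (fun y => fb (pmk x y)) (innerSL ℝ (gradient fb (pmk x y)).snd) y := by
  refine ((hdiff _).hasGradientAt.hasFDerivAt.comp y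
    ((hasFDerivAt_const x y).pmk (hasFDerivAt_id y))).congr_fderiv ?_
  ext w
  change inner ℝ (gradient fb (pmk x y)) (pmk 0 w) = _
  rw [inner_pmk, inner_zero_right, zero_add]
  rfl

theorem gradient_snd_eq_zero (hdiff : Differentiable ℝ fb) {x : E} {y₀ : F}
    (hmax : ∀ y, fb (pmk x y) ≤ fb (pmk x y₀)) : (gradient fb (pmk x y₀)).snd = 0 := by
  have hloc : IsLocalMax (fun y => fb (pmk x y)) y₀ := .of_forall hmax
  have h := hloc.hasFDerivAt_eq_zero (hasFDerivAt_partial_snd hdiff x y₀)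
  rw [← inner_self_eq_zero (𝕜 := ℝ)]
  exact congrArg (fun L : F →L[ℝ] ℝ => L (gradient fb (pmk x y₀)).snd) h

/-- The partial gradient of a strongly concave function is strongly monotone (decreasing). -/
theorem mul_sq_norm_sub_le_inner_gradient_snd (hdiff : Differentiable ℝ fb) {x : E}
    (hconcave : ConvexOn ℝ univ fun y : F => -fb (pmk x y) - μ / 2 * ‖y‖ ^ 2) (y y' : F) :
    μ * ‖y' - y‖ ^ 2 ≤
      inner ℝ ((gradient fb (pmk x y)).snd - (gradient fb (pmk x y')).snd) (y' - y) := by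
  have hφ := fun y : F => (hasFDerivAt_partial_snd hdiff x y).neg.sub
    ((hasStrictFDerivAt_norm_sq y).hasFDerivAt.const_mul (μ / 2))
  have h := hconcave.hasFDerivAt_apply_le (hφ y) (hφ y')
  simp only [sub_apply, neg_apply, smul_apply, innerSL_apply_apply, nsmul_eq_mul, smul_eq_mul] at h
  rw [← real_inner_self_eq_norm_sq]
  nth_rw 1 [inner_sub_left]
  rw [inner_sub_left]
  push_cast at h
  linarith

theorem mul_norm_sub_le_norm_gradient_snd (hdiff : Differentiable ℝ fb) {x : E}
    (hconcave : ConvexOn ℝ univ fun y : F => -fb (pmk x y) - μ / 2 * ‖y‖ ^ 2) (y y' : F) :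
    μ * ‖y' - y‖ ≤ ‖(gradient fb (pmk x y')).snd - (gradient fb (pmk x y)).snd‖ := by
  rcases (norm_nonneg (y' - y)).eq_or_lt with h0 | h0
  · rw [← h0, mul_zero]
    exact norm_nonneg _
  · refine le_of_mul_le_mul_right ?_ h0
    calc μ * ‖y' - y‖ * ‖y' - y‖ = μ * ‖y' - y‖ ^ 2 := by ring
      _ ≤ _ := mul_sq_norm_sub_le_inner_gradient_snd hdiff hconcave y y'
      _ ≤ _ := real_inner_le_norm _ _
      _ = _ := by rw [norm_sub_rev (WithLp.snd _)]

/-- The partial Hessian of a strongly concave function is bounded below. -/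
theorem mul_norm_le_norm_fderiv_gradient_snd (hdiff : Differentiable ℝ fb)
    (hdiff2 : Differentiable ℝ (gradient fb)) {x : E}
    (hconcave : ConvexOn ℝ univ fun y : F => -fb (pmk x y) - μ / 2 * ‖y‖ ^ 2) (y w : F) :
    μ * ‖w‖ ≤ ‖(fderiv ℝ (gradient fb) (pmk x y) (pmk 0 w)).snd‖ :=
  (((WithLp.sndL 2 ℝ E F).hasFDerivAt.comp _ (hdiff2 _).hasFDerivAt).comp y
    ((hasFDerivAt_const x y).pmk (hasFDerivAt_id y))).mul_norm_le_of_mul_norm_sub_le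
    (fun y' => mul_norm_sub_le_norm_gradient_snd hdiff hconcave y y') w

/-- The maximizer `y*` of a strongly concave family is `ℓ / μ`-Lipschitz. -/
theorem norm_argmax_sub_le (hμ : 0 < μ) (hdiff : Differentiable ℝ fb)
    (hlip : ∀ p q, ‖gradient fb p - gradient fb q‖ ≤ ℓ * ‖p - q‖)
    (hconcave : ∀ x : E, ConvexOn ℝ univ fun y : F => -fb (pmk x y) - μ / 2 * ‖y‖ ^ 2)
    {ys : E → F} (hmax : ∀ x y, fb (pmk x y) ≤ fb (pmk x (ys x))) (x x' : E) :
    ‖ys x - ys x'‖ ≤ ℓ / μ * ‖x - x'‖ := by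
  rw [div_mul_eq_mul_div, le_div_iff₀' hμ]
  have hnorm : ‖pmk (x' - x) (0 : F)‖ = ‖x - x'‖ := by
    rw [norm_sub_rev]
    exact WithLp.norm_toLp_fst 2 E F _
  calc μ * ‖ys x - ys x'‖
      ≤ ‖(gradient fb (pmk x (ys x))).snd - (gradient fb (pmk x (ys x'))).snd‖ :=
        mul_norm_sub_le_norm_gradient_snd hdiff (hconcave x) _ _
    _ = ‖(gradient fb (pmk x' (ys x')) - gradient fb (pmk x (ys x'))).snd‖ := by
        rw [WithLp.sub_snd, gradient_snd_eq_zero hdiff (hmax x),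
          gradient_snd_eq_zero hdiff (hmax x')]
    _ ≤ ‖gradient fb (pmk x' (ys x')) - gradient fb (pmk x (ys x'))‖ := WithLp.norm_snd_le _ _
    _ ≤ ℓ * ‖pmk x' (ys x') - pmk x (ys x')‖ := hlip _ _
    _ = ℓ * ‖x - x'‖ := by rw [pmk_sub_pmk, sub_self, hnorm]

/-- Envelope theorem: along a differentiable critical selection, only the partial gradient in
the outer variable contributes. -/
theorem hasGradientAt_comp_pmk (hdiff : Differentiable ℝ fb) {ys : E → F} {x : E}
    {J : E →L[ℝ] F} (hJ : HasFDerivAt ys J x) (hcrit : (gradient fb (pmk x (ys x))).snd = 0) :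
    HasGradientAt (fun x => fb (pmk x (ys x))) (gradient fb (pmk x (ys x))).fst x := by
  rw [hasGradientAt_iff_hasFDerivAt]
  refine ((hdiff _).hasGradientAt.hasFDerivAt.comp x
    ((hasFDerivAt_id x).pmk hJ)).congr_fderiv ?_
  ext v
  change inner ℝ (gradient fb (pmk x (ys x))) (pmk v (J v)) = _
  rw [inner_pmk, hcrit, inner_zero_left, add_zero]
  rfl

end Minimax

/-- Let `H`, `H'` be symmetric operators on an `ℓ²` product which map the graphs of `J`, `J'`
into the first factor. The corresponding Schur complements differ by the compression of `H - H'`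
to these graphs. -/
theorem norm_schur_sub_le {E F : Type*} [NormedAddCommGroup E] [InnerProductSpace ℝ E]
    [NormedAddCommGroup F] [InnerProductSpace ℝ F]
    {H H' : WithLp 2 (E × F) →L[ℝ] WithLp 2 (E × F)} {J J' : E →L[ℝ] F} {K : ℝ}
    (hsymm : ∀ p q, inner ℝ (H p) q = inner ℝ p (H q))
    (hJ : ∀ v, (H (pmk v (J v))).snd = 0) (hJ' : ∀ v, (H' (pmk v (J' v))).snd = 0)
    (hK : ‖J‖ ≤ K) (hK' : ‖J'‖ ≤ K) :
    ‖WithLp.fstL 2 ℝ E F ∘L H ∘L pmkL (.id ℝ E) J -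
      WithLp.fstL 2 ℝ E F ∘L H' ∘L pmkL (.id ℝ E) J'‖ ≤ (1 + K ^ 2) * ‖H - H'‖ := by
  refine ContinuousLinearMap.opNorm_le_of_re_inner_le (𝕜 := ℝ) (by positivity)
    fun v u hv hu => ?_
  have hpair : ∀ v u w, inner ℝ (H (pmk v (J v))) (pmk u w) =
      inner ℝ (H (pmk v (J v))).fst u := fun v u w => by
    rw [inner_pmk, hJ, inner_zero_left, add_zero]
  have hpair' : ∀ v u w, inner ℝ (H' (pmk v (J' v))) (pmk u w) =
      inner ℝ (H' (pmk v (J' v))).fst u := fun v u w => by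
    rw [inner_pmk, hJ', inner_zero_left, add_zero]
  have hcompr : inner ℝ ((H (pmk v (J v))).fst - (H' (pmk v (J' v))).fst) u =
      inner ℝ ((H - H') (pmk v (J' v))) (pmk u (J u)) := by
    have h1 : inner ℝ (H (pmk v (J' v))) (pmk u (J u)) = inner ℝ (H (pmk v (J v))).fst u := by
      rw [hsymm, real_inner_comm, hpair, ← hpair u v (J v), hsymm, real_inner_comm, hpair]
    rw [sub_apply, inner_sub_left, inner_sub_left, h1, hpair']
  have hS : ‖pmk u (J u)‖ ≤ √(1 + K ^ 2) := by
    simpa [hu] using norm_pmk_le (J.le_of_opNorm_le hK u)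
  have hS' : ‖pmk v (J' v)‖ ≤ √(1 + K ^ 2) := by
    simpa [hv] using norm_pmk_le (J'.le_of_opNorm_le hK' v)
  calc inner ℝ ((H (pmk v (J v))).fst - (H' (pmk v (J' v))).fst) u
      ≤ ‖(H - H') (pmk v (J' v))‖ * ‖pmk u (J u)‖ := hcompr ▸ real_inner_le_norm _ _
    _ ≤ ‖H - H'‖ * √(1 + K ^ 2) * √(1 + K ^ 2) := by
        gcongr
        exact (H - H').le_opNorm_of_le hS'
    _ = (1 + K ^ 2) * ‖H - H'‖ := by
        rw [mul_assoc, Real.mul_self_sqrt (by positivity), mul_comm]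


/-- **Smoothness of the max-function in nonconvex-strongly-concave minimax problems.**
If `f̄` is twice differentiable with `ℓ`-Lipschitz gradient and `ρ`-Lipschitz second
derivative, and `μ`-strongly concave in `y` (`0 < μ ≤ ℓ`, `κ = ℓ/μ`), then
`Φ̄(x) = max_y f̄(x,y) = f̄(x, y*(x))` is differentiable with `(κ+1)ℓ`-Lipschitz
gradient and twice differentiable with `4√2·κ³ρ`-Lipschitz Hessian. -/
theorem minimax_smoothness
    {E F : Type*}
    [NormedAddCommGroup E] [InnerProductSpace ℝ E] [FiniteDimensional ℝ E]
    [NormedAddCommGroup F] [InnerProductSpace ℝ F] [FiniteDimensional ℝ F]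
    (fb : WithLp 2 (E × F) → ℝ) (ℓ μ ρ : ℝ) (hμ : 0 < μ) (hμℓ : μ ≤ ℓ) (hρ : 0 < ρ)
    (hdiff : Differentiable ℝ fb) (hdiff2 : Differentiable ℝ (gradient fb))
    (hlip : LipschitzWith ℓ.toNNReal (gradient fb))
    (hhess : ∀ p p' : WithLp 2 (E × F),
      ‖fderiv ℝ (gradient fb) p - fderiv ℝ (gradient fb) p'‖ ≤ ρ * ‖p - p'‖)
    (hconcave : ∀ x : E, ConvexOn ℝ Set.univ
      (fun y : F => -fb (pmk x y) - μ / 2 * ‖y‖ ^ 2))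
    (ystar : E → F)
    (hmax : ∀ x : E, ∀ y : F, fb (pmk x y) ≤ fb (pmk x (ystar x)))
    (κ : ℝ) (hκ : κ = ℓ / μ)
    (Φb : E → ℝ) (hΦb : ∀ x : E, Φb x = fb (pmk x (ystar x))) :
    Differentiable ℝ Φb ∧
      (∀ x x' : E, ‖gradient Φb x - gradient Φb x'‖ ≤ (κ + 1) * ℓ * ‖x - x'‖) ∧
      Differentiable ℝ (gradient Φb) ∧
      (∀ x x' : E, ‖fderiv ℝ (gradient Φb) x - fderiv ℝ (gradient Φb) x'‖
        ≤ 4 * Real.sqrt 2 * κ ^ 3 * ρ * ‖x - x'‖) := by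
  have hκ1 : 1 ≤ κ := by rwa [hκ, one_le_div hμ]
  have hgrad : ∀ p q, ‖gradient fb p - gradient fb q‖ ≤ ℓ * ‖p - q‖ := fun p q => by
    simpa [dist_eq_norm, hμ.le.trans hμℓ] using hlip.dist_le_mul p q
  have hys : ∀ x x', ‖ystar x - ystar x'‖ ≤ κ * ‖x - x'‖ :=
    hκ ▸ norm_argmax_sub_le hμ hdiff hgrad hconcave hmax
  have hcrit : ∀ x, (gradient fb (pmk x (ystar x))).snd = 0 :=
    fun x => gradient_snd_eq_zero hdiff (hmax x)
  have hsnd : ∀ p, HasFDerivAt (fun p => (gradient fb p).snd)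
      (WithLp.sndL 2 ℝ E F ∘L fderiv ℝ (gradient fb) p) p :=
    fun p => (WithLp.sndL 2 ℝ E F).hasFDerivAt.comp p (hdiff2 p).hasFDerivAt
  have himp : ∀ x, ∃ J : E →L[ℝ] F, HasFDerivAt ystar J x ∧
      ∀ v, (fderiv ℝ (gradient fb) (pmk x (ystar x)) (pmk v (J v))).snd = 0 := fun x => by
    have h := exists_hasFDerivAt_of_implicit hμ (hsnd (pmk x (ystar x))).differentiableAt hcrit
      (fun x' => hys x' x) (by
        rw [(hsnd _).fderiv]
        exact mul_norm_le_norm_fderiv_gradient_snd hdiff hdiff2 (hconcave x) _)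
    rwa [(hsnd _).fderiv] at h
  choose J hJ hHJ using himp
  have hJκ : ∀ x, ‖J x‖ ≤ κ := fun x =>
    (hJ x).le_of_lip' (zero_le_one.trans hκ1) (.of_forall fun x' => hys x' x)
  obtain rfl : Φb = fun x => fb (pmk x (ystar x)) := funext hΦb
  have hΦ : ∀ x, HasGradientAt (fun x => fb (pmk x (ystar x)))
      (gradient fb (pmk x (ystar x))).fst x :=
    fun x => hasGradientAt_comp_pmk hdiff (hJ x) (hcrit x)
  have hΦ2 : ∀ x, HasFDerivAt (fun x => (gradient fb (pmk x (ystar x))).fst)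
      (WithLp.fstL 2 ℝ E F ∘L fderiv ℝ (gradient fb) (pmk x (ystar x)) ∘L
        pmkL (.id ℝ E) (J x)) x := fun x =>
    (WithLp.fstL 2 ℝ E F).hasFDerivAt.comp x
      ((hdiff2 _).hasFDerivAt.comp x ((hasFDerivAt_id x).pmk (hJ x)))
  have hZ : ∀ x x', ‖pmk x (ystar x) - pmk x' (ystar x')‖ ≤ √(1 + κ ^ 2) * ‖x - x'‖ :=
    fun x x' => norm_pmk_le (hys x x')
  refine ⟨fun x => (hΦ x).differentiableAt, ?_⟩
  rw [gradient_eq hΦ]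
  refine ⟨fun x x' => ?_, fun x => (hΦ2 x).differentiableAt, fun x x' => ?_⟩
  · have hsqrt : √(1 + κ ^ 2) ≤ κ + 1 :=
      Real.sqrt_le_iff.2 ⟨by linarith, by nlinarith⟩
    calc ‖(gradient fb (pmk x (ystar x))).fst - (gradient fb (pmk x' (ystar x'))).fst‖
        ≤ ‖gradient fb (pmk x (ystar x)) - gradient fb (pmk x' (ystar x'))‖ :=
          WithLp.sub_fst (gradient fb _) _ ▸ WithLp.norm_fst_le _ _
      _ ≤ ℓ * ((κ + 1) * ‖x - x'‖) := (hgrad _ _).trans <|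
          mul_le_mul_of_nonneg_left ((hZ x x').trans (by gcongr)) (hμ.le.trans hμℓ)
      _ = (κ + 1) * ℓ * ‖x - x'‖ := by ring
  · rw [(hΦ2 x).fderiv, (hΦ2 x').fderiv]
    have hsqrt : √(1 + κ ^ 2) ≤ √2 * κ :=
      Real.sqrt_le_iff.2 ⟨by positivity, by rw [mul_pow, Real.sq_sqrt] <;> nlinarith⟩
    calc _ ≤ (1 + κ ^ 2) * ‖fderiv ℝ (gradient fb) (pmk x (ystar x)) -
            fderiv ℝ (gradient fb) (pmk x' (ystar x'))‖ :=
          norm_schur_sub_le (inner_fderiv_gradient_comm hdiff (hdiff2 _)) (hHJ x) (hHJ x')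
            (hJκ x) (hJκ x')
      _ ≤ (4 * κ ^ 2) * (ρ * (√2 * κ * ‖x - x'‖)) := by
          gcongr
          · nlinarith
          · refine (hhess _ _).trans ?_
            gcongr
            exact (hZ x x').trans (by gcongr)
      _ = 4 * √2 * κ ^ 3 * ρ * ‖x - x'‖ := by ring
end
end
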